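/- arXiv:2311.13943 — 2 statements merged into one kernel-verified Lean document; each statement's English description precedes it below -/
import Mathlib

section
/- If G is a unicyclic graph with n ≥ 5 vertices, then PS(G) ≤ 6·F(n−2) + 2·F(n−3), with equality if and only if G ≅ D(3, n−3), the triangle with a pendant path of length n−3 attached. -/
open SimpleGraph Finset
open scoped Classical

noncomputable section

namespace PermSum

variable {V W : Type*}

/-- Number of cycle components of the spanning subgraph with edge set `M`:
components all of whose vertices have degree `2`. -/
noncomputable def numCycles [Fintype V] (M : Finset (Sym2 V)) : ℕ :=
  Nat.card {c : (fromEdgeSet (↑M : Set (Sym2 V))).ConnectedComponent //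
    ∀ v, (fromEdgeSet (↑M : Set (Sym2 V))).connectedComponentMk v = c →
      (fromEdgeSet (↑M : Set (Sym2 V))).degree v = 2}

/-- `M` is the edge set of a Sachs subgraph of `G`: each component of the graph it spans is a
single edge or a cycle (every covered vertex has degree 1 or 2, and any vertex of degree 1 has
its neighbours of degree 1). -/
def IsSachs [Fintype V] (G : SimpleGraph V) (M : Finset (Sym2 V)) : Prop :=
  (↑M : Set (Sym2 V)) ⊆ G.edgeSet ∧
  (∀ v ∈ (fromEdgeSet (↑M : Set (Sym2 V))).support,
      (fromEdgeSet (↑M : Set (Sym2 V))).degree v = 1 ∨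
      (fromEdgeSet (↑M : Set (Sym2 V))).degree v = 2) ∧
  (∀ v w, (fromEdgeSet (↑M : Set (Sym2 V))).Adj v w →
      (fromEdgeSet (↑M : Set (Sym2 V))).degree v = 1 →
      (fromEdgeSet (↑M : Set (Sym2 V))).degree w = 1)

/-- The permanental sum of a finite simple graph: `∑_H 2^{c(H)}` over all Sachs subgraphs `H`
(including the empty one). -/
noncomputable def PS [Fintype V] (G : SimpleGraph V) : ℕ :=
  ∑ M ∈ Finset.univ.filter (fun M : Finset (Sym2 V) => IsSachs G M), 2 ^ numCycles M


/-- `D(3, m)`: a triangle with a pendant path on `m` further vertices (total `m + 3`),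
obtained from the path `0-1-⋯-(m+2)` by adding the edge `{0, 2}`. -/
def D3 (m : ℕ) : SimpleGraph (Fin (m + 3)) :=
  pathGraph (m + 3) ⊔ fromEdgeSet {s((0 : Fin (m + 3)), (2 : Fin (m + 3)))}

/-- The number of neighbours of `x`, with the instances fixed once and for all. -/
def dg [Fintype V] (G : SimpleGraph V) (x : V) : ℕ := #{y | G.Adj x y}

lemma degree_eq_dg [Fintype V] (G : SimpleGraph V) (x : V) [Fintype (G.neighborSet x)] :
    G.degree x = dg G x := by
  rw [dg, ← card_neighborFinset_eq_degree]
  congr 1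
  ext y
  simp

lemma dg_pos_iff [Fintype V] {G : SimpleGraph V} {x : V} : 0 < dg G x ↔ ∃ y, G.Adj x y := by
  simp [dg, Finset.card_pos, Finset.Nonempty]

lemma dg_eq_one_iff [Fintype V] {G : SimpleGraph V} {x : V} :
    dg G x = 1 ↔ ∃ u, ∀ y, G.Adj x y ↔ y = u := by
  simp only [dg, Finset.card_eq_one, Finset.ext_iff, mem_filter_univ, mem_singleton]

lemma dg_congr [Fintype V] {G H : SimpleGraph V} {x y : V} (h : ∀ z, G.Adj x z ↔ H.Adj y z) :
    dg G x = dg H y := by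
  simp only [dg, h]

/-- The graph spanned by a finite set of edges. -/
abbrev spanned (M : Finset (Sym2 V)) : SimpleGraph V := fromEdgeSet (↑M : Set (Sym2 V))

lemma isSachs_iff [Fintype V] (G : SimpleGraph V) (M : Finset (Sym2 V)) :
    IsSachs G M ↔ (↑M : Set (Sym2 V)) ⊆ G.edgeSet ∧
      (∀ v, dg (spanned M) v ≤ 2) ∧
      (∀ v w, (spanned M).Adj v w → dg (spanned M) v = 1 → dg (spanned M) w = 1) := by
  unfold IsSachs
  simp only [degree_eq_dg]
  refine and_congr_right fun _ => and_congr_left fun _ => forall_congr' fun v => ?_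
  have : v ∈ (spanned M).support ↔ 0 < dg (spanned M) v := by rw [mem_support, dg_pos_iff]
  rw [this]
  change (_ → dg (spanned M) v = 1 ∨ dg (spanned M) v = 2) ↔ _
  omega

lemma numCycles_eq [Fintype V] (M : Finset (Sym2 V)) :
    numCycles M = Set.ncard {T : Set V | T.Nonempty ∧
      (∀ x ∈ T, ∀ y, y ∈ T ↔ (spanned M).Reachable x y) ∧ ∀ x ∈ T, dg (spanned M) x = 2} := by
  unfold numCycles
  simp only [degree_eq_dg]
  rw [← Nat.card_coe_set_eq]
  refine Nat.card_congr (Equiv.ofBijective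
    (fun c => ⟨c.1.supp, c.1.nonempty_supp, ?_, fun x hx => c.2 x hx⟩) ⟨?_, ?_⟩)
  · intro x hx y
    rw [ConnectedComponent.mem_supp_iff] at hx ⊢
    rw [← hx, ConnectedComponent.eq]
    exact ⟨Reachable.symm, Reachable.symm⟩
  · intro c d h
    exact Subtype.ext (ConnectedComponent.supp_injective (congrArg Subtype.val h))
  · rintro ⟨T, ⟨x, hx⟩, h1, h2⟩
    have hT : ∀ y, y ∈ T ↔ (spanned M).connectedComponentMk y =
        (spanned M).connectedComponentMk x := by
      intro y
      rw [h1 x hx, ConnectedComponent.eq]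
      exact ⟨Reachable.symm, Reachable.symm⟩
    refine ⟨⟨(spanned M).connectedComponentMk x, fun v hv => h2 v ((hT v).2 hv)⟩, ?_⟩
    apply Subtype.ext
    ext y
    simp only [ConnectedComponent.mem_supp_iff, hT]

lemma numCycles_eq_zero [Fintype V] {M : Finset (Sym2 V)} (h : ∀ x, dg (spanned M) x ≠ 2) :
    numCycles M = 0 := by
  rw [numCycles_eq]
  convert Set.ncard_empty (Set V)
  rw [Set.eq_empty_iff_forall_notMem]
  rintro T ⟨⟨x, hx⟩, -, h2⟩
  exact h x (h2 x hx)

lemma spanned_insert_adj {M : Finset (Sym2 V)} {a b : V} (x y : V) :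
    (spanned (insert s(a, b) M)).Adj x y ↔
      (spanned M).Adj x y ∨ (x ≠ y ∧ (x = a ∧ y = b ∨ x = b ∧ y = a)) := by
  simp only [fromEdgeSet_adj, coe_insert, Set.mem_insert_iff, Sym2.eq_iff, mem_coe]
  tauto

lemma not_adj_of_dg_eq_zero [Fintype V] {G : SimpleGraph V} {x : V} (h : dg G x = 0) (y : V) :
    ¬ G.Adj x y := fun hxy => (dg_pos_iff.2 ⟨y, hxy⟩).ne' h

lemma dg_insert_of_ne [Fintype V] {M : Finset (Sym2 V)} {a b : V} {x : V} (hxa : x ≠ a)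
    (hxb : x ≠ b) :
    dg (spanned (insert s(a, b) M)) x = dg (spanned M) x :=
  dg_congr fun z => by rw [spanned_insert_adj]; tauto

lemma dg_insert_left [Fintype V] {M : Finset (Sym2 V)} {a b : V} (hab : a ≠ b)
    (ha : dg (spanned M) a = 0) :
    dg (spanned (insert s(a, b) M)) a = 1 := by
  rw [dg_eq_one_iff]
  refine ⟨b, fun y => ?_⟩
  rw [spanned_insert_adj]
  have := not_adj_of_dg_eq_zero ha y
  constructor
  · rintro (h | ⟨h, h' | h'⟩) <;> tauto
  · rintro rfl
    tauto

lemma dg_insert_right [Fintype V] {M : Finset (Sym2 V)} {a b : V} (hab : a ≠ b)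
    (hb : dg (spanned M) b = 0) :
    dg (spanned (insert s(a, b) M)) b = 1 := by
  rw [Sym2.eq_swap]
  exact dg_insert_left hab.symm hb

lemma numCycles_insert [Fintype V] {M : Finset (Sym2 V)} {a b : V} (hab : a ≠ b)
    (ha : dg (spanned M) a = 0) (hb : dg (spanned M) b = 0) :
    numCycles (insert s(a, b) M) = numCycles M := by
  have hle : spanned M ≤ spanned (insert s(a, b) M) := fun x y h =>
    (spanned_insert_adj x y).2 (Or.inl h)
  have hdeg : ∀ x, dg (spanned (insert s(a, b) M)) x = 2 ↔ dg (spanned M) x = 2 := by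
    intro x
    by_cases hxa : x = a
    · subst hxa; rw [dg_insert_left hab ha, ha]; simp
    by_cases hxb : x = b
    · subst hxb; rw [dg_insert_right hab hb, hb]; simp
    rw [dg_insert_of_ne hxa hxb]
  have key : ∀ T : Set V, (∀ x ∈ T, dg (spanned M) x = 2) → ∀ x ∈ T,
      (∀ z ∈ T, ∀ y, (spanned M).Adj z y → y ∈ T) → ∀ y,
      (spanned (insert s(a, b) M)).Reachable x y → y ∈ T ∧ (spanned M).Reachable x y := by
    intro T hT x hx hcl y hxy
    rw [reachable_iff_reflTransGen] at hxy
    induction hxy with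
    | refl => exact ⟨hx, Reachable.refl x⟩
    | @tail z w _ hzw ih =>
      have h2 := hT z ih.1
      have hadj : (spanned M).Adj z w := by
        rcases (spanned_insert_adj z w).1 hzw with h | ⟨-, ⟨rfl, -⟩ | ⟨rfl, -⟩⟩
        · exact h
        · omega
        · omega
      exact ⟨hcl z ih.1 w hadj, ih.2.trans hadj.reachable⟩
  rw [numCycles_eq, numCycles_eq]
  congr 1
  ext T
  simp only [Set.mem_ofPred_eq, hdeg]
  refine and_congr_right fun _ => and_congr_left fun hT => ⟨fun h x hx y => ?_, fun h x hx y => ?_⟩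
  · have hcl : ∀ z ∈ T, ∀ y, (spanned M).Adj z y → y ∈ T := fun z hz y hzy =>
      (h z hz y).2 (hle hzy).reachable
    exact ⟨fun hy => (key T hT x hx hcl y ((h x hx y).1 hy)).2,
      fun hy => (h x hx y).2 (hy.mono hle)⟩
  · have hcl : ∀ z ∈ T, ∀ y, (spanned M).Adj z y → y ∈ T := fun z hz y hzy =>
      (h z hz y).2 hzy.reachable
    exact ⟨fun hy => ((h x hx y).1 hy).mono hle, fun hy => (key T hT x hx hcl y hy).1⟩
/-- The graph obtained by deleting all edges at the vertices `a` and `b`. -/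
def isolate (G : SimpleGraph V) (a b : V) : SimpleGraph V where
  Adj x y := G.Adj x y ∧ x ≠ a ∧ x ≠ b ∧ y ≠ a ∧ y ≠ b
  symm := ⟨fun _ _ h => ⟨h.1.symm, h.2.2.2.1, h.2.2.2.2, h.2.1, h.2.2.1⟩⟩
  loopless := ⟨fun _ h => h.1.ne rfl⟩

lemma isolate_adj {G : SimpleGraph V} {a b x y : V} :
    (isolate G a b).Adj x y ↔ G.Adj x y ∧ x ≠ a ∧ x ≠ b ∧ y ≠ a ∧ y ≠ b := Iff.rfl

lemma isolate_le (G : SimpleGraph V) (a b : V) : isolate G a b ≤ G := fun _ _ h => h.1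

lemma subset_edgeSet_iff {G : SimpleGraph V} {M : Finset (Sym2 V)} :
    (↑M : Set (Sym2 V)) ⊆ G.edgeSet ↔ ∀ x y, s(x, y) ∈ M → G.Adj x y := by
  refine ⟨fun h x y hxy => h hxy, fun h e => ?_⟩
  induction e with
  | h x y => exact h x y

lemma isSachs_deleteEdges_iff [Fintype V] {G : SimpleGraph V} {M : Finset (Sym2 V)} {a b : V} :
    IsSachs (G.deleteEdges {s(a, b)}) M ↔ IsSachs G M ∧ s(a, b) ∉ M := by
  simp only [isSachs_iff, edgeSet_deleteEdges, Set.subset_sdiff, Set.disjoint_singleton_right,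
    mem_coe]
  tauto

lemma spanned_adj_iff_mem [Fintype V] {G : SimpleGraph V} {M : Finset (Sym2 V)}
    (h : (↑M : Set (Sym2 V)) ⊆ G.edgeSet) {x y : V} : (spanned M).Adj x y ↔ s(x, y) ∈ M := by
  rw [fromEdgeSet_adj, mem_coe]
  exact ⟨fun h => h.1, fun hm => ⟨hm, (subset_edgeSet_iff.1 h x y hm).ne⟩⟩

lemma isSachs_isolate_iff [Fintype V] {G : SimpleGraph V} {M : Finset (Sym2 V)} {a b : V}
    (hab : G.Adj a b) :
    IsSachs (isolate G a b) M ↔ s(a, b) ∉ M ∧ IsSachs G (insert s(a, b) M) ∧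
      dg (spanned (insert s(a, b) M)) a = 1 := by
  constructor
  · intro h
    have hsub := ((isSachs_iff _ _).1 h).1
    have hs := subset_edgeSet_iff.1 hsub
    have h0 : dg (spanned M) a = 0 := by
      by_contra hne
      obtain ⟨y, hy⟩ := dg_pos_iff.1 (Nat.pos_of_ne_zero hne)
      exact (hs _ _ ((spanned_adj_iff_mem hsub).1 hy)).2.1 rfl
    have h0' : dg (spanned M) b = 0 := by
      by_contra hne
      obtain ⟨y, hy⟩ := dg_pos_iff.1 (Nat.pos_of_ne_zero hne)
      exact (hs _ _ ((spanned_adj_iff_mem hsub).1 hy)).2.2.1 rfl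
    have ha := dg_insert_left hab.ne h0
    have hb := dg_insert_right hab.ne h0'
    obtain ⟨-, h2, h3⟩ := (isSachs_iff _ _).1 h
    refine ⟨fun hm => (hs a b hm).2.1 rfl, (isSachs_iff _ _).2 ⟨?_, fun v => ?_, ?_⟩, ha⟩
    · rw [coe_insert, Set.insert_subset_iff]
      exact ⟨hab, hsub.trans (edgeSet_mono (isolate_le G a b))⟩
    · by_cases hva : v = a
      · subst hva; omega
      by_cases hvb : v = b
      · subst hvb; omega
      rw [dg_insert_of_ne hva hvb]
      exact h2 v
    · intro v w hvw hv
      rcases (spanned_insert_adj v w).1 hvw with h | ⟨-, ⟨rfl, rfl⟩ | ⟨rfl, rfl⟩⟩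
      · have := hs v w ((spanned_adj_iff_mem hsub).1 h)
        rw [isolate_adj] at this
        rw [dg_insert_of_ne this.2.1 this.2.2.1] at hv
        rw [dg_insert_of_ne this.2.2.2.1 this.2.2.2.2]
        exact h3 v w h hv
      · exact hb
      · exact ha
  · rintro ⟨hm, h, ha⟩
    obtain ⟨hsub, h2, h3⟩ := (isSachs_iff _ _).1 h
    have hs := subset_edgeSet_iff.1 hsub
    have hadj : (spanned (insert s(a, b) M)).Adj a b :=
      (spanned_adj_iff_mem hsub).2 (mem_insert_self _ _)
    have hb := h3 a b hadj ha
    have key : ∀ x y, s(x, y) ∈ M → x ≠ a ∧ x ≠ b := by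
      intro x y hxy
      have hxy' := (spanned_adj_iff_mem hsub).2 (mem_insert_of_mem (b := s(a, b)) hxy)
      constructor
      · rintro rfl
        obtain ⟨u, hu⟩ := dg_eq_one_iff.1 ha
        obtain rfl := (hu _).1 hadj
        obtain rfl := (hu _).1 hxy'
        exact hm hxy
      · rintro rfl
        obtain ⟨u, hu⟩ := dg_eq_one_iff.1 hb
        obtain rfl := (hu _).1 hadj.symm
        obtain rfl := (hu _).1 hxy'
        exact hm (Sym2.eq_swap ▸ hxy)
    have hsub' : (↑M : Set (Sym2 V)) ⊆ (isolate G a b).edgeSet := by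
      rw [subset_edgeSet_iff]
      intro x y hxy
      have h1 := key x y hxy
      have h2 := key y x (Sym2.eq_swap ▸ hxy)
      exact ⟨hs x y (mem_insert_of_mem hxy), h1.1, h1.2, h2.1, h2.2⟩
    refine (isSachs_iff _ _).2 ⟨hsub', fun v => ?_, fun v w hvw hv => ?_⟩
    · by_contra hv
      obtain ⟨y, hy⟩ := dg_pos_iff.1 (show 0 < dg (spanned M) v by omega)
      have := key v y ((spanned_adj_iff_mem hsub').1 hy)
      have h2 := h2 v
      rw [dg_insert_of_ne this.1 this.2] at h2
      exact hv h2
    · have hv' := key v w ((spanned_adj_iff_mem hsub').1 hvw)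
      have hw' := key w v ((spanned_adj_iff_mem hsub').1 hvw.symm)
      rw [← dg_insert_of_ne hw'.1 hw'.2]
      rw [← dg_insert_of_ne hv'.1 hv'.2] at hv
      exact h3 v w ((spanned_insert_adj v w).2 (Or.inl hvw)) hv

lemma PS_eq_add [Fintype V] {G : SimpleGraph V} {a b : V} (hab : G.Adj a b) :
    PS G = PS (G.deleteEdges {s(a, b)}) + PS (isolate G a b) +
      ∑ M with IsSachs G M ∧ s(a, b) ∈ M ∧ dg (spanned M) a ≠ 1, 2 ^ numCycles M := by
  have h1 : PS (isolate G a b) =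
      ∑ M with IsSachs G M ∧ s(a, b) ∈ M ∧ dg (spanned M) a = 1, 2 ^ numCycles M := by
    unfold PS
    refine sum_nbij' (fun M => insert s(a, b) M) (fun M => M.erase s(a, b)) ?_ ?_ ?_ ?_ ?_
    · intro M hM
      rw [mem_filter_univ] at hM ⊢
      have := (isSachs_isolate_iff hab).1 hM
      exact ⟨this.2.1, mem_insert_self _ _, this.2.2⟩
    · intro M hM
      rw [mem_filter_univ] at hM ⊢
      rw [isSachs_isolate_iff hab, insert_erase hM.2.1]
      exact ⟨notMem_erase _ _, hM.1, hM.2.2⟩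
    · intro M hM
      rw [mem_filter_univ] at hM
      exact erase_insert ((isSachs_isolate_iff hab).1 hM).1
    · intro M hM
      rw [mem_filter_univ] at hM
      exact insert_erase hM.2.1
    · intro M hM
      rw [mem_filter_univ] at hM
      have hsub := ((isSachs_iff _ _).1 hM).1
      have hs := subset_edgeSet_iff.1 hsub
      rw [numCycles_insert hab.ne]
      · by_contra hne
        obtain ⟨y, hy⟩ := dg_pos_iff.1 (Nat.pos_of_ne_zero hne)
        exact (hs _ _ ((spanned_adj_iff_mem hsub).1 hy)).2.1 rfl
      · by_contra hne
        obtain ⟨y, hy⟩ := dg_pos_iff.1 (Nat.pos_of_ne_zero hne)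
        exact (hs _ _ ((spanned_adj_iff_mem hsub).1 hy)).2.2.1 rfl
  rw [h1]
  unfold PS
  simp only [isSachs_deleteEdges_iff]
  rw [← sum_filter_not_add_sum_filter _ (fun M => s(a, b) ∈ M),
    ← sum_filter_add_sum_filter_not (filter (fun M => s(a, b) ∈ M) _)
      (fun M => dg (spanned M) a = 1)]
  simp only [filter_filter, and_assoc, add_assoc, ne_eq]
lemma dg_mono [Fintype V] {G H : SimpleGraph V} (h : G ≤ H) (x : V) : dg G x ≤ dg H x :=
  card_le_card fun y hy => by
    rw [mem_filter_univ] at hy ⊢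
    exact h hy

lemma spanned_le [Fintype V] {G : SimpleGraph V} {M : Finset (Sym2 V)} (h : IsSachs G M) :
    spanned M ≤ G := by
  have hsub := ((isSachs_iff _ _).1 h).1
  exact fun x y hxy => subset_edgeSet_iff.1 hsub x y ((spanned_adj_iff_mem hsub).1 hxy)

lemma PS_bot [Fintype V] : PS (⊥ : SimpleGraph V) = 1 := by
  have h0 : ∀ x : V, dg (spanned (∅ : Finset (Sym2 V))) x = 0 := by
    intro x; simp [dg]
  have : ({M | IsSachs (⊥ : SimpleGraph V) M} : Finset (Finset (Sym2 V))) = {∅} := by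
    ext M
    rw [mem_filter_univ, mem_singleton, isSachs_iff]
    constructor
    · rintro ⟨h, -⟩
      simpa using h
    · rintro rfl
      simp [h0]
  rw [PS, this, sum_singleton, numCycles_eq_zero, pow_zero]
  intro x
  rw [h0]
  omega

lemma PS_leaf [Fintype V] {G : SimpleGraph V} {a b : V} (hab : G.Adj a b) (ha : dg G a = 1) :
    PS G = PS (G.deleteEdges {s(a, b)}) + PS (isolate G a b) := by
  rw [PS_eq_add hab, add_eq_left, sum_eq_zero]
  intro M hM
  rw [mem_filter_univ] at hM
  obtain ⟨h1, h2, h3⟩ := hM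
  have hadj := (spanned_adj_iff_mem ((isSachs_iff _ _).1 h1).1).2 h2
  have := dg_pos_iff.2 ⟨b, hadj⟩
  have := dg_mono (spanned_le h1) a
  omega

/-- All edges of `G` lie inside `S`. -/
def SupportedOn (G : SimpleGraph V) (S : Finset V) : Prop := ∀ ⦃x y⦄, G.Adj x y → x ∈ S

lemma SupportedOn.isolate {G : SimpleGraph V} {S : Finset V} (h : SupportedOn G S) (a b : V) :
    SupportedOn (isolate G a b) ((S.erase a).erase b) := fun _ _ hxy =>
  mem_erase.2 ⟨hxy.2.2.1, mem_erase.2 ⟨hxy.2.1, h hxy.1⟩⟩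

lemma SupportedOn.erase [Fintype V] {G : SimpleGraph V} {S : Finset V} (h : SupportedOn G S)
    {a : V} (ha : dg G a = 0) : SupportedOn G (S.erase a) := fun x y hxy =>
  mem_erase.2 ⟨by rintro rfl; exact not_adj_of_dg_eq_zero ha y hxy, h hxy⟩

lemma deleteEdges_pair_adj {G : SimpleGraph V} {a b x y : V} :
    (G.deleteEdges {s(a, b)}).Adj x y ↔ G.Adj x y ∧ ¬ (x = a ∧ y = b ∨ x = b ∧ y = a) := by
  rw [deleteEdges_adj, Set.mem_singleton_iff, Sym2.eq_iff]

lemma dg_deleteEdges_leaf [Fintype V] {G : SimpleGraph V} {a b : V} (hab : G.Adj a b)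
    (ha : dg G a = 1) : dg (G.deleteEdges {s(a, b)}) a = 0 := by
  obtain ⟨u, hu⟩ := dg_eq_one_iff.1 ha
  by_contra hne
  obtain ⟨y, hy⟩ := dg_pos_iff.1 (Nat.pos_of_ne_zero hne)
  rw [deleteEdges_pair_adj] at hy
  have h1 := (hu y).1 hy.1
  have h2 := (hu b).1 hab
  exact hy.2 (Or.inl ⟨rfl, h1.trans h2.symm⟩)

lemma SupportedOn.mono {G H : SimpleGraph V} {S : Finset V} (h : SupportedOn G S) (hle : H ≤ G) :
    SupportedOn H S := fun _ _ hxy => h (hle hxy)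

lemma SupportedOn.deleteEdges_leaf [Fintype V] {G : SimpleGraph V} {S : Finset V}
    (h : SupportedOn G S) {a b : V} (hab : G.Adj a b) (ha : dg G a = 1) :
    SupportedOn (G.deleteEdges {s(a, b)}) (S.erase a) :=
  (h.mono (deleteEdges_le _)).erase (dg_deleteEdges_leaf hab ha)

/-- The number of ordered pairs of adjacent vertices inside `T`. -/
def pairCount (G : SimpleGraph V) (T : Finset V) : ℕ := #{p ∈ T ×ˢ T | G.Adj p.1 p.2}

lemma pairCount_eq_sum (G : SimpleGraph V) (T : Finset V) :
    pairCount G T = ∑ x ∈ T, #{y ∈ T | G.Adj x y} := by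
  simp only [pairCount, card_filter, sum_product]

lemma pairCount_eq_sum_dg [Fintype V] {G : SimpleGraph V} {T : Finset V}
    (h : ∀ x ∈ T, ∀ y, G.Adj x y → y ∈ T) : pairCount G T = ∑ x ∈ T, dg G x := by
  rw [pairCount_eq_sum]
  refine sum_congr rfl fun x hx => ?_
  rw [dg]
  congr 1
  ext y
  simpa using h x hx y

lemma pairCount_mono {G H : SimpleGraph V} (h : G ≤ H) (T : Finset V) :
    pairCount G T ≤ pairCount H T :=
  card_le_card fun p hp => by
    rw [mem_filter] at hp ⊢
    exact ⟨hp.1, h hp.2⟩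

/-- Every nonempty vertex set `T` spans at most `|T| - 1` edges. -/
def Forest (G : SimpleGraph V) : Prop :=
  ∀ T : Finset V, T.Nonempty → pairCount G T + 2 ≤ 2 * #T

lemma Forest.mono {G H : SimpleGraph V} (hH : Forest H) (h : G ≤ H) : Forest G := fun T hT =>
  (Nat.add_le_add_right (pairCount_mono h T) 2).trans (hH T hT)

lemma forest_of_isAcyclic {G : SimpleGraph V} (h : G.IsAcyclic) : Forest G := by
  intro T hT
  have : Nonempty T := hT.to_subtype
  obtain ⟨F, hle, -, hF⟩ := (connected_top (V := T)).exists_isTree_le_of_le_of_isAcyclic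
    (H := G.induce (T : Set V)) le_top (h.induce _)
  have h1 := hF.card_edgeFinset
  have h2 := F.sum_degrees_eq_twice_card_edges
  have h3 : Fintype.card (T : Set V) = #T := Fintype.card_coe T
  suffices pairCount G T ≤ ∑ v, F.degree v by omega
  rw [pairCount_eq_sum, ← sum_coe_sort T]
  refine sum_le_sum fun x _ => ?_
  rw [degree_eq_dg, dg]
  refine card_le_card_of_surjOn (fun y => (y : V)) ?_
  intro y hy
  rw [mem_coe, mem_filter] at hy
  exact ⟨⟨y, hy.1⟩, by simpa using hle (show (G.induce (T : Set V)).Adj x ⟨y, hy.1⟩ from hy.2), rfl⟩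

lemma Forest.exists_dg_le_one [Fintype V] {G : SimpleGraph V} (hG : Forest G) {S : Finset V}
    (hS : SupportedOn G S) (hne : S.Nonempty) : ∃ v ∈ S, dg G v ≤ 1 := by
  by_contra! h
  have h1 := hG S hne
  rw [pairCount_eq_sum_dg fun x _ y hxy => hS hxy.symm] at h1
  have h2 := card_nsmul_le_sum S (fun x => dg G x) 2 fun x hx => h x hx
  rw [smul_eq_mul] at h2
  omega

lemma Forest.PS_le [Fintype V] {G : SimpleGraph V} (hG : Forest G) {S : Finset V}
    (hS : SupportedOn G S) : PS G ≤ Nat.fib (#S + 1) := by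
  induction h : #S using Nat.strong_induction_on generalizing G S with
  | _ n ih =>
  rcases S.eq_empty_or_nonempty with rfl | hne
  · have : G = ⊥ := by
      ext x y
      simpa using fun hxy => notMem_empty _ (hS hxy)
    rw [this, PS_bot]
    exact Nat.fib_pos.2 (Nat.succ_pos _)
  obtain ⟨a, haS, ha⟩ := hG.exists_dg_le_one hS hne
  have hc := card_erase_of_mem haS
  have hpos := hne.card_pos
  obtain ⟨m, rfl⟩ : ∃ m, n = m + 1 := ⟨n - 1, by omega⟩
  rcases Nat.le_one_iff_eq_zero_or_eq_one.1 ha with ha | ha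
  · exact (ih m (by omega) hG (hS.erase ha) (by omega)).trans (Nat.fib_mono (by omega))
  · obtain ⟨b, hb⟩ := dg_pos_iff.1 (show 0 < dg G a by omega)
    have hbS : b ∈ S.erase a := mem_erase.2 ⟨hb.ne', hS hb.symm⟩
    have hc' := card_erase_of_mem hbS
    have hpos' := card_pos.2 ⟨b, hbS⟩
    obtain ⟨k, rfl⟩ : ∃ k, m = k + 1 := ⟨m - 1, by omega⟩
    have h1 := ih (k + 1) (by omega) (hG.mono (deleteEdges_le _)) (hS.deleteEdges_leaf hb ha)
      (by omega)
    have h2 := ih k (by omega) (hG.mono (isolate_le G a b)) (hS.isolate a b) (by omega)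
    rw [PS_leaf hb ha, Nat.fib_add_two]
    omega

/-- `G` is a cycle with vertex set `S`, possibly together with isolated vertices. -/
structure IsCycleOn [Fintype V] (G : SimpleGraph V) (S : Finset V) : Prop where
  dg_eq : ∀ x ∈ S, dg G x = 2
  eq_of_closed : ∀ T ⊆ S, T.Nonempty → (∀ x ∈ T, ∀ y, G.Adj x y → y ∈ T) → T = S

lemma adj_iff_of_dg_le [Fintype V] {G H : SimpleGraph V} (h : G ≤ H) {x : V}
    (hx : dg H x ≤ dg G x) (y : V) : G.Adj x y ↔ H.Adj x y := by
  have : ({y | G.Adj x y} : Finset V) = ({y | H.Adj x y} : Finset V) :=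
    eq_of_subset_of_card_le (fun y hy => by rw [mem_filter_univ] at hy ⊢; exact h hy) hx
  simpa using Finset.ext_iff.1 this y

lemma PS_cycle [Fintype V] {G : SimpleGraph V} {S : Finset V} (hS : SupportedOn G S)
    (hG : IsCycleOn G S) {a b : V} (hab : G.Adj a b) :
    PS G = PS (G.deleteEdges {s(a, b)}) + PS (isolate G a b) + 2 := by
  have hspan : spanned G.edgeFinset = G := by
    rw [spanned, coe_edgeFinset, fromEdgeSet_edgeSet]
  have hle2 : ∀ x, dg G x ≤ 2 := by
    intro x
    by_cases hx : x ∈ S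
    · exact (hG.dg_eq x hx).le
    · by_contra hne
      obtain ⟨y, hy⟩ := dg_pos_iff.1 (show 0 < dg G x by omega)
      exact hx (hS hy)
  have hfil : ({M | IsSachs G M ∧ s(a, b) ∈ M ∧ dg (spanned M) a ≠ 1} : Finset (Finset (Sym2 V))) =
      {G.edgeFinset} := by
    ext M
    rw [mem_filter_univ, mem_singleton]
    constructor
    · rintro ⟨h1, h2, h3⟩
      obtain ⟨hsub, hd, hd1⟩ := (isSachs_iff _ _).1 h1
      have hadj := (spanned_adj_iff_mem hsub).2 h2
      have hle := spanned_le h1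
      have hda : dg (spanned M) a = 2 := by
        have := dg_pos_iff.2 ⟨b, hadj⟩
        have := hd a
        omega
      have hiff : ∀ x, dg (spanned M) x = 2 → ∀ y, (spanned M).Adj x y ↔ G.Adj x y :=
        fun x hx y => adj_iff_of_dg_le hle (by rw [hx]; exact hle2 x) y
      have hT : ({x | dg (spanned M) x = 2} : Finset V) = S := by
        refine hG.eq_of_closed _ ?_ ⟨a, by simpa using hda⟩ ?_
        · intro x hx
          rw [mem_filter_univ] at hx
          obtain ⟨y, hy⟩ := dg_pos_iff.1 (show 0 < dg (spanned M) x by omega)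
          exact hS (hle hy)
        · intro x hx y hxy
          rw [mem_filter_univ] at hx ⊢
          have hxy' := (hiff x hx y).2 hxy
          have h4 := dg_pos_iff.2 ⟨x, hxy'.symm⟩
          have h5 := hd y
          have h6 := hd1 y x hxy'.symm
          omega
      ext e
      induction e with
      | h x y =>
      rw [mem_edgeFinset, mem_edgeSet, ← spanned_adj_iff_mem hsub]
      refine ⟨fun h => hle h, fun h => (hiff x ?_ y).2 h⟩
      have := hS h
      rw [← hT] at this
      simpa using this
    · rintro rfl
      rw [isSachs_iff, hspan, mem_edgeFinset, hG.dg_eq a (hS hab)]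
      refine ⟨⟨by simp, hle2, fun v w hvw hv => ?_⟩, hab, by omega⟩
      have := hG.dg_eq v (hS hvw)
      omega
  rw [PS_eq_add hab, hfil, sum_singleton]
  suffices numCycles G.edgeFinset = 1 by rw [this, pow_one]
  rw [numCycles_eq, Set.ncard_eq_one, hspan]
  refine ⟨(S : Set V), ?_⟩
  have hreach : ∀ x ∈ S, ∀ y, y ∈ S ↔ G.Reachable x y := by
    intro x hx y
    constructor
    · intro hy
      have : ({y | G.Reachable x y} : Finset V) = S := by
        refine hG.eq_of_closed _ ?_ ⟨x, by simp⟩ ?_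
        · intro z hz
          rw [mem_filter_univ, reachable_iff_reflTransGen] at hz
          cases hz with
          | refl => exact hx
          | tail _ h => exact hS h.symm
        · intro z hz w hzw
          rw [mem_filter_univ] at hz ⊢
          exact hz.trans hzw.reachable
      rw [← this] at hy
      simpa using hy
    · intro h
      rw [reachable_iff_reflTransGen] at h
      cases h with
      | refl => exact hx
      | tail _ h => exact hS h.symm
  ext T
  rw [Set.mem_ofPred_eq, Set.mem_singleton_iff]
  constructor
  · rintro ⟨⟨x, hx⟩, h1, h2⟩
    have hxS : x ∈ S := by
      obtain ⟨y, hy⟩ := dg_pos_iff.1 (show 0 < dg G x by rw [h2 x hx]; omega)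
      exact hS hy
    ext y
    rw [h1 x hx, mem_coe, hreach x hxS]
  · rintro rfl
    exact ⟨⟨a, hS hab⟩, hreach, hG.dg_eq⟩
/-- Some edge deletion turns `G` into a forest. -/
def AtMostUnicyclic (G : SimpleGraph V) : Prop := ∃ a b, Forest (G.deleteEdges {s(a, b)})

lemma AtMostUnicyclic.mono {G H : SimpleGraph V} (hH : AtMostUnicyclic H) (h : G ≤ H) :
    AtMostUnicyclic G := by
  obtain ⟨a, b, hF⟩ := hH
  exact ⟨a, b, hF.mono (deleteEdges_mono h)⟩

lemma pairCount_le_add_two {G H : SimpleGraph V} {a b : V}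
    (h : ∀ x y, G.Adj x y → H.Adj x y ∨ x = a ∧ y = b ∨ x = b ∧ y = a) (T : Finset V) :
    pairCount G T ≤ pairCount H T + 2 := by
  have : ({p ∈ T ×ˢ T | G.Adj p.1 p.2} : Finset (V × V)) ⊆
      ({p ∈ T ×ˢ T | H.Adj p.1 p.2} : Finset (V × V)) ∪ {(a, b), (b, a)} := by
    rintro ⟨x, y⟩ hxy
    simp only [mem_filter, mem_union, mem_insert, mem_singleton, Prod.mk.injEq] at hxy ⊢
    have := h x y hxy.2
    tauto
  exact (card_le_card this).trans ((card_union_le _ _).trans (Nat.add_le_add_left card_le_two _))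

lemma pairCount_le_deleteEdges (G : SimpleGraph V) (a b : V) (T : Finset V) :
    pairCount G T ≤ pairCount (G.deleteEdges {s(a, b)}) T + 2 :=
  pairCount_le_add_two (fun x y hxy => by rw [deleteEdges_pair_adj]; tauto) T

lemma pairCount_eq_deleteEdges {G : SimpleGraph V} {a b : V} {T : Finset V}
    (h : ¬ (a ∈ T ∧ G.Adj a b)) : pairCount G T = pairCount (G.deleteEdges {s(a, b)}) T := by
  unfold pairCount
  congr 1
  ext ⟨x, y⟩
  simp only [mem_filter, deleteEdges_pair_adj, mem_product]
  constructor
  · rintro ⟨⟨hx, hy⟩, hxy⟩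
    refine ⟨⟨hx, hy⟩, hxy, ?_⟩
    rintro (⟨rfl, rfl⟩ | ⟨rfl, rfl⟩)
    · exact h ⟨hx, hxy⟩
    · exact h ⟨hy, hxy.symm⟩
  · rintro ⟨hT, hxy, -⟩
    exact ⟨hT, hxy⟩

lemma AtMostUnicyclic.pairCount_le {G : SimpleGraph V} (hG : AtMostUnicyclic G) (T : Finset V) :
    pairCount G T ≤ 2 * #T := by
  rcases T.eq_empty_or_nonempty with rfl | hT
  · simp [pairCount]
  · obtain ⟨a, b, hF⟩ := hG
    exact (pairCount_le_deleteEdges G a b T).trans (hF T hT)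

lemma Forest.mem_of_le_pairCount {G : SimpleGraph V} {a b : V}
    (hF : Forest (G.deleteEdges {s(a, b)})) {T : Finset V} (hT : T.Nonempty)
    (h : 2 * #T ≤ pairCount G T) : a ∈ T ∧ G.Adj a b := by
  by_contra hne
  rw [pairCount_eq_deleteEdges hne] at h
  have := hF T hT
  omega

lemma AtMostUnicyclic.exists_isCycleOn [Fintype V] {G : SimpleGraph V} (hG : AtMostUnicyclic G)
    {S : Finset V} (hS : SupportedOn G S) (hne : S.Nonempty) (hd : ∀ x ∈ S, 2 ≤ dg G x) :
    IsCycleOn G S ∧ ∃ a b, G.Adj a b ∧ Forest (G.deleteEdges {s(a, b)}) := by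
  have hle : ∀ T ⊆ S, (∀ x ∈ T, ∀ y, G.Adj x y → y ∈ T) → 2 * #T ≤ pairCount G T := by
    intro T hTS hT
    rw [pairCount_eq_sum_dg hT]
    have := card_nsmul_le_sum T (fun x => dg G x) 2 fun x hx => hd x (hTS hx)
    rw [smul_eq_mul] at this
    omega
  have hSc : ∀ x ∈ S, ∀ y, G.Adj x y → y ∈ S := fun x _ y hxy => hS hxy.symm
  have hup := hG.pairCount_le S
  obtain ⟨a, b, hF⟩ := hG
  have hab := hF.mem_of_le_pairCount hne (hle S Subset.rfl hSc)
  refine ⟨⟨fun x hx => ?_, fun T hTS hTne hT => ?_⟩, a, b, hab.2, hF⟩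
  · rw [pairCount_eq_sum_dg hSc] at hup
    have h1 : ∑ x ∈ S, 2 = ∑ x ∈ S, dg G x :=
      le_antisymm (sum_le_sum hd) (by rw [sum_const, smul_eq_mul]; omega)
    exact (((sum_eq_sum_iff_of_le hd).1 h1) x hx).symm
  · by_contra hneq
    have hne' : (S \ T).Nonempty := by
      rw [sdiff_nonempty]
      exact fun h => hneq (Subset.antisymm hTS h)
    have h1 := hF.mem_of_le_pairCount hTne (hle T hTS hT)
    have h2 := hF.mem_of_le_pairCount hne' (hle _ sdiff_subset fun x hx y hxy => by
      rw [mem_sdiff] at hx ⊢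
      exact ⟨hS hxy.symm, fun hy => hx.2 (hT y hy x hxy.symm)⟩)
    exact (mem_sdiff.1 h2.1).2 h1.1

lemma forest_of_card_le_two {G : SimpleGraph V} {S : Finset V} (hS : SupportedOn G S)
    (hc : #S ≤ 2) : Forest G := by
  intro T hT
  have h1 : pairCount G T ≤ #(T ∩ S).offDiag := by
    refine card_le_card fun p hp => ?_
    rw [mem_filter, mem_product] at hp
    exact mem_offDiag.2 ⟨mem_inter.2 ⟨hp.1.1, hS hp.2⟩, mem_inter.2 ⟨hp.1.2, hS hp.2.symm⟩,
      hp.2.ne⟩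
  rw [offDiag_card] at h1
  have h2 : #(T ∩ S) ≤ #T := card_le_card inter_subset_left
  have h3 : #(T ∩ S) ≤ #S := card_le_card inter_subset_right
  have h4 := hT.card_pos
  generalize #(T ∩ S) = k at h1 h2 h3
  have : k ≤ 2 := h3.trans hc
  interval_cases k <;> omega

lemma PS_cycle_le [Fintype V] {G : SimpleGraph V} (hG : AtMostUnicyclic G)
    {S : Finset V} (hS : SupportedOn G S) (hd : ∀ x ∈ S, 2 ≤ dg G x) {k : ℕ} (hk : #S = k + 2) :
    IsCycleOn G S ∧ PS G ≤ Nat.fib (k + 3) + Nat.fib (k + 1) + 2 := by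
  obtain ⟨hC, a, b, hab, hF⟩ := hG.exists_isCycleOn hS (card_pos.1 (by omega)) hd
  refine ⟨hC, ?_⟩
  have hle : isolate G a b ≤ G.deleteEdges {s(a, b)} := fun x y h => by
    rw [deleteEdges_pair_adj]
    exact ⟨h.1, by have := h.2; tauto⟩
  have h1 := hF.PS_le (hS.mono (deleteEdges_le _))
  have h2 := (hF.mono hle).PS_le (hS.isolate a b)
  rw [card_erase_of_mem (mem_erase.2 ⟨hab.ne', hS hab.symm⟩), card_erase_of_mem (hS hab), hk] at h2
  rw [hk] at h1
  rw [PS_cycle hS hC hab]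
  have : k + 2 - 1 - 1 + 1 = k + 1 := by omega
  rw [this] at h2
  rw [show k + 2 + 1 = k + 3 by omega] at h1
  omega

/-- The number of edges of `G`, with the instances fixed once and for all. -/
def edgeCount [Fintype V] (G : SimpleGraph V) : ℕ := #G.edgeFinset

lemma edgeCount_eq [Fintype V] (G : SimpleGraph V) [Fintype G.edgeSet] :
    edgeCount G = #G.edgeFinset := by
  rw [edgeCount]
  congr!

lemma sum_dg_eq [Fintype V] {G : SimpleGraph V} {S : Finset V} (hS : SupportedOn G S) :
    ∑ x ∈ S, dg G x = 2 * edgeCount G := by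
  rw [edgeCount, ← sum_degrees_eq_twice_card_edges]
  simp only [degree_eq_dg]
  refine sum_subset (subset_univ S) fun x _ hx => ?_
  by_contra hne
  obtain ⟨y, hy⟩ := dg_pos_iff.1 (Nat.pos_of_ne_zero hne)
  exact hx (hS hy)

lemma AtMostUnicyclic.edgeCount_le [Fintype V] {G : SimpleGraph V} (hG : AtMostUnicyclic G)
    {S : Finset V} (hS : SupportedOn G S) : edgeCount G ≤ #S := by
  have := hG.pairCount_le S
  rw [pairCount_eq_sum_dg fun x _ y hxy => hS hxy.symm, sum_dg_eq hS] at this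
  omega

lemma IsCycleOn.edgeCount [Fintype V] {G : SimpleGraph V} {S : Finset V}
    (hG : IsCycleOn G S) (hS : SupportedOn G S) : edgeCount G = #S := by
  have := sum_dg_eq hS
  rw [sum_congr rfl hG.dg_eq, sum_const, smul_eq_mul] at this
  omega

lemma edgeCount_deleteEdges_add_one [Fintype V] {G : SimpleGraph V} {a b : V}
    (hab : G.Adj a b) : edgeCount (G.deleteEdges {s(a, b)}) + 1 = edgeCount G := by
  have : (G.deleteEdges {s(a, b)}).edgeFinset = G.edgeFinset.erase s(a, b) := by
    ext e
    simp only [mem_edgeFinset, edgeSet_deleteEdges, mem_erase, Set.mem_sdiff,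
      Set.mem_singleton_iff]
    tauto
  rw [edgeCount_eq, edgeCount_eq, this, card_erase_add_one]
  simpa using hab

lemma edgeCount_isolate_add [Fintype V] {G : SimpleGraph V} {a b : V}
    (hab : G.Adj a b) (ha : dg G a = 1) :
    edgeCount (isolate G a b) + dg (G.deleteEdges {s(a, b)}) b =
      edgeCount (G.deleteEdges {s(a, b)}) := by
  set H := G.deleteEdges {s(a, b)} with hH
  have h0 := not_adj_of_dg_eq_zero (dg_deleteEdges_leaf hab ha)
  have : (isolate G a b).edgeFinset = H.edgeFinset \ H.incidenceFinset b := by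
    ext e
    induction e with
    | h x y =>
    have hx : x = a → ¬ H.Adj x y := by rintro rfl; exact h0 y
    have hy : y = a → ¬ H.Adj x y := by rintro rfl h; exact h0 x h.symm
    simp only [mem_edgeFinset, mem_edgeSet, mem_sdiff, mem_incidenceFinset, incidenceSet,
      Set.mem_sep_iff, Sym2.mem_iff, isolate_adj]
    have := deleteEdges_pair_adj (G := G) (a := a) (b := b) (x := x) (y := y)
    rw [← hH] at this
    constructor
    · rintro ⟨h1, h2, h3, h4, h5⟩
      have : H.Adj x y := this.2 ⟨h1, by tauto⟩
      exact ⟨this, fun h => by rcases h.2 with h | h <;> [exact h3 h.symm; exact h5 h.symm]⟩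
    · rintro ⟨h1, h2⟩
      exact ⟨(this.1 h1).1, fun h => hx h h1, fun h => h2 ⟨h1, Or.inl h.symm⟩,
        fun h => hy h h1, fun h => h2 ⟨h1, Or.inr h.symm⟩⟩
  rw [edgeCount_eq, edgeCount_eq, this, ← degree_eq_dg, ← card_incidenceFinset_eq_degree]
  exact card_sdiff_add_card_eq_card (incidenceFinset_subset H b)
/-- Adjacency of the triangle `0, 1, 2` with the pendant path `2, 3, …`. -/
def TadpoleAdj (i j : ℕ) : Prop := j = i + 1 ∨ i = j + 1 ∨ (i = 0 ∧ j = 2) ∨ (i = 2 ∧ j = 0)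

/-- `p` enumerates `S` so that `G` is the triangle `p 0, p 1, p 2` with the pendant path
`p 2, p 3, …, p (m + 2)`. -/
structure IsTadpole (G : SimpleGraph V) (S : Finset V) (m : ℕ) (p : ℕ → V) : Prop where
  supp : SupportedOn G S
  inj : ∀ i < m + 3, ∀ j < m + 3, p i = p j → i = j
  mem_iff : ∀ x, x ∈ S ↔ ∃ i < m + 3, p i = x
  adj : ∀ i < m + 3, ∀ j < m + 3, (G.Adj (p i) (p j) ↔ TadpoleAdj i j)

section Tadpole

variable {G : SimpleGraph V} {S : Finset V} {m : ℕ} {p : ℕ → V}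

lemma IsTadpole.mem (h : IsTadpole G S m p) {i : ℕ} (hi : i < m + 3) : p i ∈ S :=
  (h.mem_iff _).2 ⟨i, hi, rfl⟩

lemma IsTadpole.ne (h : IsTadpole G S m p) {i j : ℕ} (hi : i < m + 3) (hj : j < m + 3)
    (hij : i ≠ j) : p i ≠ p j := fun he => hij (h.inj i hi j hj he)

lemma IsTadpole.of_forall_adj (hS : SupportedOn G S) (hc : #S = 3)
    (hadj : ∀ x ∈ S, ∀ y ∈ S, x ≠ y → G.Adj x y) {b : V} (hb : b ∈ S) :
    ∃ p, IsTadpole G S 0 p ∧ p 2 = b := by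
  have hc' : #(S.erase b) = 2 := by rw [card_erase_of_mem hb, hc]
  obtain ⟨x, y, hxy, hxyS⟩ := card_eq_two.1 hc'
  have hS' : S = {b, x, y} := by rw [← insert_erase hb, hxyS]
  have hxb : x ≠ b := (mem_erase.1 (by rw [hxyS]; simp : x ∈ S.erase b)).1
  have hyb : y ≠ b := (mem_erase.1 (by rw [hxyS]; simp : y ∈ S.erase b)).1
  have hx : x ∈ S := by rw [hS']; simp
  have hy : y ∈ S := by rw [hS']; simp
  have inj : ∀ i < 0 + 3, ∀ j < 0 + 3, (if i = 0 then x else if i = 1 then y else b) =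
      (if j = 0 then x else if j = 1 then y else b) → i = j := by
    intro i hi j hj
    have := hxb.symm
    have := hyb.symm
    have := hxy.symm
    interval_cases i <;> interval_cases j <;> simp_all
  have mem : ∀ i, (if i = 0 then x else if i = 1 then y else b) ∈ S := by
    intro i; split_ifs <;> assumption
  refine ⟨fun i => if i = 0 then x else if i = 1 then y else b, ⟨hS, inj, ?_, ?_⟩, rfl⟩
  · intro z
    rw [hS']
    simp only [mem_insert, mem_singleton]
    constructor
    · rintro (rfl | rfl | rfl)
      · exact ⟨2, by omega, rfl⟩
      · exact ⟨0, by omega, rfl⟩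
      · exact ⟨1, by omega, rfl⟩
    · rintro ⟨i, -, rfl⟩
      split_ifs <;> simp
  · intro i hi j hj
    have h1 : TadpoleAdj i j ↔ i ≠ j := by unfold TadpoleAdj; omega
    rw [h1]
    constructor
    · rintro h rfl
      exact h.ne rfl
    · exact fun h => hadj _ (mem i) _ (mem j) fun he => h (inj i hi j hj he)

lemma IsTadpole.adj_of_ne (h : IsTadpole G S 0 p) : ∀ x ∈ S, ∀ y ∈ S, x ≠ y → G.Adj x y := by
  intro x hx y hy hxy
  obtain ⟨i, hi, rfl⟩ := (h.mem_iff x).1 hx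
  obtain ⟨j, hj, rfl⟩ := (h.mem_iff y).1 hy
  have : i ≠ j := fun he => hxy (he ▸ rfl)
  exact (h.adj i hi j hj).2 (by unfold TadpoleAdj; omega)

lemma IsTadpole.card (h : IsTadpole G S m p) : #S = m + 3 := by
  have : S = (range (m + 3)).image p := by
    ext x
    simp [h.mem_iff]
  rw [this, card_image_of_injOn, card_range]
  intro i hi j hj
  exact h.inj i (by simpa using hi) j (by simpa using hj)

lemma IsTadpole.extend [Fintype V] {a b : V}
    (h : IsTadpole (G.deleteEdges {s(a, b)}) (S.erase a) m p) (hS : SupportedOn G S)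
    (hb : p (m + 2) = b) (hab : G.Adj a b) (ha : dg G a = 1) :
    IsTadpole G S (m + 1) (Function.update p (m + 3) a) := by
  have haS := hS hab
  have hlt : ∀ i < m + 3, Function.update p (m + 3) a i = p i := fun i hi =>
    Function.update_of_ne hi.ne _ _
  have hlast : Function.update p (m + 3) a (m + 3) = a := Function.update_self _ _ _
  have hpa : ∀ i < m + 3, p i ≠ a := fun i hi => (mem_erase.1 (h.mem hi)).1
  have hadja : ∀ i < m + 3, (G.Adj a (p i) ↔ i = m + 2) := by
    intro i hi
    obtain ⟨u, hu⟩ := dg_eq_one_iff.1 ha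
    have hub := (hu b).1 hab
    subst hub
    rw [hu, ← hb]
    exact ⟨fun he => h.inj i hi _ (by omega) he, fun he => he ▸ rfl⟩
  refine ⟨hS, ?_, ?_, ?_⟩
  · intro i hi j hj hij
    rcases Nat.lt_succ_iff_lt_or_eq.1 hi with hi | rfl <;>
      rcases Nat.lt_succ_iff_lt_or_eq.1 hj with hj | rfl
    · rw [hlt i hi, hlt j hj] at hij
      exact h.inj i hi j hj hij
    · rw [hlt i hi, hlast] at hij
      exact (hpa i hi hij).elim
    · rw [hlt j hj, hlast] at hij
      exact (hpa j hj hij.symm).elim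
    · rfl
  · intro x
    constructor
    · intro hx
      by_cases hxa : x = a
      · exact ⟨m + 3, by omega, by rw [hlast, hxa]⟩
      · obtain ⟨i, hi, rfl⟩ := (h.mem_iff x).1 (mem_erase.2 ⟨hxa, hx⟩)
        exact ⟨i, by omega, hlt i hi⟩
    · rintro ⟨i, hi, rfl⟩
      rcases Nat.lt_succ_iff_lt_or_eq.1 hi with hi | rfl
      · rw [hlt i hi]
        exact mem_of_mem_erase (h.mem hi)
      · rwa [hlast]
  · intro i hi j hj
    rcases Nat.lt_succ_iff_lt_or_eq.1 hi with hi | rfl <;>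
      rcases Nat.lt_succ_iff_lt_or_eq.1 hj with hj | rfl
    · rw [hlt i hi, hlt j hj, ← h.adj i hi j hj, deleteEdges_pair_adj]
      have := hpa i hi
      have := hpa j hj
      tauto
    · rw [hlt i hi, hlast, G.adj_comm, hadja i hi, TadpoleAdj]
      omega
    · rw [hlt j hj, hlast, hadja j hj, TadpoleAdj]
      omega
    · rw [hlast, TadpoleAdj]
      simp

lemma IsTadpole.adj_last (h : IsTadpole G S (m + 1) p) : G.Adj (p (m + 3)) (p (m + 2)) :=
  (h.adj _ (by omega) _ (by omega)).2 (by unfold TadpoleAdj; omega)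

lemma IsTadpole.dg_last [Fintype V] (h : IsTadpole G S (m + 1) p) : dg G (p (m + 3)) = 1 := by
  refine dg_eq_one_iff.2 ⟨p (m + 2), fun y => ⟨fun hy => ?_, ?_⟩⟩
  · obtain ⟨j, hj, rfl⟩ := (h.mem_iff y).1 (h.supp hy.symm)
    have := (h.adj _ (by omega) _ hj).1 hy
    unfold TadpoleAdj at this
    have : j = m + 2 := by omega
    rw [this]
  · rintro rfl
    exact h.adj_last

lemma IsTadpole.deleteEdges [Fintype V] (h : IsTadpole G S (m + 1) p) :
    IsTadpole (G.deleteEdges {s(p (m + 3), p (m + 2))}) (S.erase (p (m + 3))) m p := by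
  refine ⟨h.supp.deleteEdges_leaf h.adj_last h.dg_last,
    fun i hi j hj => h.inj i (by omega) j (by omega), fun x => ?_, fun i hi j hj => ?_⟩
  · rw [mem_erase, h.mem_iff]
    constructor
    · rintro ⟨hx, i, hi, rfl⟩
      have : i ≠ m + 3 := by rintro rfl; exact hx rfl
      exact ⟨i, by omega, rfl⟩
    · rintro ⟨i, hi, rfl⟩
      exact ⟨h.ne (by omega) (by omega) (by omega), i, by omega, rfl⟩
  · have h1 : p i ≠ p (m + 3) := h.ne (by omega) (by omega) (by omega)
    have h2 : p j ≠ p (m + 3) := h.ne (by omega) (by omega) (by omega)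
    rw [deleteEdges_pair_adj, h.adj i (by omega) j (by omega)]
    exact and_iff_left (by tauto)

lemma IsTadpole.isolate (h : IsTadpole G S (m + 2) p) :
    IsTadpole (isolate G (p (m + 4)) (p (m + 3))) ((S.erase (p (m + 4))).erase (p (m + 3))) m p := by
  refine ⟨h.supp.isolate _ _, fun i hi j hj => h.inj i (by omega) j (by omega), fun x => ?_,
    fun i hi j hj => ?_⟩
  · rw [mem_erase, mem_erase, h.mem_iff]
    constructor
    · rintro ⟨hx, hx', i, hi, rfl⟩
      have : i ≠ m + 3 := by rintro rfl; exact hx rfl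
      have : i ≠ m + 4 := by rintro rfl; exact hx' rfl
      exact ⟨i, by omega, rfl⟩
    · rintro ⟨i, hi, rfl⟩
      exact ⟨h.ne (by omega) (by omega) (by omega), h.ne (by omega) (by omega) (by omega), i,
        by omega, rfl⟩
  · rw [isolate_adj, h.adj i (by omega) j (by omega)]
    exact and_iff_left ⟨h.ne (by omega) (by omega) (by omega),
      h.ne (by omega) (by omega) (by omega), h.ne (by omega) (by omega) (by omega),
      h.ne (by omega) (by omega) (by omega)⟩

lemma IsTadpole.two_le_dg [Fintype V] (h : IsTadpole G S m p) {i : ℕ} (hi : i < m + 2) :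
    2 ≤ dg G (p i) := by
  obtain ⟨j, hj, hij, hadj⟩ : ∃ j < m + 3, j ≠ i + 1 ∧ TadpoleAdj i j := by
    unfold TadpoleAdj
    rcases Nat.eq_zero_or_pos i with rfl | h0
    · exact ⟨2, by omega, by omega, by omega⟩
    · exact ⟨i - 1, by omega, by omega, by omega⟩
  rw [dg, ← Finset.card_pair (h.ne hj (show i + 1 < m + 3 by omega) hij)]
  refine card_le_card fun x hx => ?_
  rw [mem_filter_univ]
  rcases mem_insert.1 hx with rfl | hx
  · exact (h.adj i (by omega) j hj).2 hadj
  · rw [mem_singleton.1 hx]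
    exact (h.adj i (by omega) _ (by omega)).2 (Or.inl rfl)

lemma eq_bot_of_forall {G : SimpleGraph V} (h : ∀ x y, ¬ G.Adj x y) : G = ⊥ := by
  ext x y
  simpa using h x y

lemma PS_edge [Fintype V] {G : SimpleGraph V} {a b : V} (hab : G.Adj a b)
    (h : ∀ x y, G.Adj x y → x = a ∧ y = b ∨ x = b ∧ y = a) : PS G = 2 := by
  have ha : dg G a = 1 := dg_eq_one_iff.2 ⟨b, fun y => ⟨fun hy => by
    rcases h a y hy with h | h
    · exact h.2
    · exact (hab.ne h.1).elim, fun hy => hy ▸ hab⟩⟩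
  rw [PS_leaf hab ha, eq_bot_of_forall (G := G.deleteEdges _), eq_bot_of_forall
    (G := PermSum.isolate G a b), PS_bot]
  · intro x y hxy
    have := h x y hxy.1
    have := hxy.2
    tauto
  · intro x y hxy
    rw [deleteEdges_pair_adj] at hxy
    exact hxy.2 (h x y hxy.1)

lemma IsTadpole.isCycleOn [Fintype V] (h : IsTadpole G S 0 p) : IsCycleOn G S := by
  refine ⟨fun x hx => ?_, fun T hTS hT hcl => ?_⟩
  · have : ({y | G.Adj x y} : Finset V) = S.erase x := by
      ext y
      rw [mem_filter_univ, mem_erase]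
      exact ⟨fun hy => ⟨hy.ne', h.supp hy.symm⟩, fun hy => h.adj_of_ne x hx y hy.2 hy.1.symm⟩
    rw [dg, this, card_erase_of_mem hx, h.card]
  · refine Subset.antisymm hTS fun y hy => ?_
    obtain ⟨x, hx⟩ := hT
    by_cases hxy : x = y
    · exact hxy ▸ hx
    · exact hcl x hx y (h.adj_of_ne x (hTS hx) y hy hxy)

lemma IsTadpole.PS_zero [Fintype V] (h : IsTadpole G S 0 p) : PS G = 6 := by
  have h01 : G.Adj (p 0) (p 1) := (h.adj _ (by omega) _ (by omega)).2 (by unfold TadpoleAdj; omega)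
  have h02 : G.Adj (p 0) (p 2) := (h.adj _ (by omega) _ (by omega)).2 (by unfold TadpoleAdj; omega)
  have h12 : G.Adj (p 1) (p 2) := (h.adj _ (by omega) _ (by omega)).2 (by unfold TadpoleAdj; omega)
  have cov : ∀ x y, G.Adj x y → x = p 0 ∨ x = p 1 ∨ x = p 2 := by
    intro x y hxy
    obtain ⟨i, hi, rfl⟩ := (h.mem_iff x).1 (h.supp hxy)
    interval_cases i <;> simp
  set H := G.deleteEdges {s(p 0, p 1)} with hH
  have hH02 : H.Adj (p 0) (p 2) := by
    rw [hH, deleteEdges_pair_adj]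
    have := h12.ne
    have := h02.ne
    tauto
  have hH12 : H.Adj (p 1) (p 2) := by
    rw [hH, deleteEdges_pair_adj]
    have := h12.ne
    have := h02.ne
    tauto
  have hdg : dg H (p 0) = 1 := by
    refine dg_eq_one_iff.2 ⟨p 2, fun y => ⟨fun hy => ?_, fun hy => hy ▸ hH02⟩⟩
    have := cov _ _ hy.symm.1
    have := hy.ne
    rw [hH, deleteEdges_pair_adj] at hy
    tauto
  rw [PS_cycle h.supp h.isCycleOn h01, PS_leaf hH02 hdg,
    eq_bot_of_forall (G := PermSum.isolate G _ _), eq_bot_of_forall (G := PermSum.isolate H _ _),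
    PS_bot, PS_edge (a := p 1) (b := p 2)]
  · rw [deleteEdges_pair_adj]
    have := h01.ne
    have := h12.ne
    tauto
  · intro x y hxy
    rw [deleteEdges_pair_adj] at hxy
    have h1 := cov _ _ hxy.1.1
    have h2 := cov _ _ hxy.1.1.symm
    have h3 := hxy.1.ne
    have h4 := hxy.1
    rw [hH, deleteEdges_pair_adj] at h4
    grind
  · intro x y hxy
    have h1 := cov _ _ hxy.1.1
    have h2 := cov _ _ hxy.1.1.symm
    have h3 := hxy.1.ne
    have h4 := hxy.2
    grind
  · intro x y hxy
    have h1 := cov _ _ hxy.1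
    have h2 := cov _ _ hxy.1.symm
    have h3 := hxy.1.ne
    have h4 := hxy.2
    grind

lemma IsTadpole.PS_eq [Fintype V] (h : IsTadpole G S m p) :
    PS G = Nat.fib (m + 4) + 3 * Nat.fib (m + 1) := by
  induction m using Nat.strong_induction_on generalizing G S with
  | _ m ih =>
  rcases m with - | m
  · rw [h.PS_zero]
    rfl
  rw [PS_leaf h.adj_last h.dg_last, ih m (by omega) h.deleteEdges]
  rcases m with - | m
  · have h01 : G.Adj (p 0) (p 1) :=
      (h.adj _ (by omega) _ (by omega)).2 (by unfold TadpoleAdj; omega)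
    rw [PS_edge (a := p 0) (b := p 1)]
    · rfl
    · rw [isolate_adj]
      exact ⟨h01, h.ne (by omega) (by omega) (by omega), h.ne (by omega) (by omega) (by omega),
        h.ne (by omega) (by omega) (by omega), h.ne (by omega) (by omega) (by omega)⟩
    · rintro x y ⟨hxy, h1, h2, h3, h4⟩
      obtain ⟨i, hi, rfl⟩ := (h.mem_iff x).1 (h.supp hxy)
      obtain ⟨j, hj, rfl⟩ := (h.mem_iff y).1 (h.supp hxy.symm)
      have hij := hxy.ne
      interval_cases i <;> interval_cases j <;> simp_all
  · rw [ih m (by omega) h.isolate]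
    have h1 := Nat.fib_add_two (n := m + 4)
    have h2 := Nat.fib_add_two (n := m + 1)
    rw [show m + 1 + 1 + 4 = m + 4 + 2 by ring, show m + 1 + 1 + 1 = m + 1 + 2 by ring, h1, h2]
    rw [show m + 1 + 4 = m + 4 + 1 by ring]
    ring

end Tadpole
lemma AtMostUnicyclic.isolate {G : SimpleGraph V} (h : AtMostUnicyclic G) (a b : V) :
    AtMostUnicyclic (isolate G a b) := h.mono (isolate_le G a b)

lemma AtMostUnicyclic.deleteEdges {G : SimpleGraph V} (h : AtMostUnicyclic G) (s : Set (Sym2 V)) :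
    AtMostUnicyclic (G.deleteEdges s) := h.mono (deleteEdges_le s)

/-- A vertex of degree at most one is isolated or a leaf. -/
lemma isolated_or_leaf [Fintype V] {G : SimpleGraph V} {S : Finset V} (hS : SupportedOn G S)
    {a : V} (haS : a ∈ S) {k : ℕ} (hc : #S = k + 1) (ha : dg G a ≤ 1) :
    (SupportedOn G (S.erase a) ∧ #(S.erase a) = k) ∨
      ∃ b, G.Adj a b ∧ dg G a = 1 ∧ b ∈ S.erase a ∧
        SupportedOn (G.deleteEdges {s(a, b)}) (S.erase a) ∧ #(S.erase a) = k ∧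
        SupportedOn (isolate G a b) ((S.erase a).erase b) ∧ #((S.erase a).erase b) + 1 = k ∧
        PS G = PS (G.deleteEdges {s(a, b)}) + PS (isolate G a b) := by
  have h1 := card_erase_of_mem haS
  rcases Nat.le_one_iff_eq_zero_or_eq_one.1 ha with ha | ha
  · exact Or.inl ⟨hS.erase ha, by omega⟩
  · obtain ⟨b, hab⟩ := dg_pos_iff.1 (show 0 < dg G a by omega)
    have hb : b ∈ S.erase a := mem_erase.2 ⟨hab.ne', hS hab.symm⟩
    have h2 := card_erase_add_one hb
    exact Or.inr ⟨b, hab, ha, hb, hS.deleteEdges_leaf hab ha, by omega, hS.isolate a b, by omega,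
      PS_leaf hab ha⟩

lemma PS_le_fib_of_card_le_two [Fintype V] {G : SimpleGraph V} {S : Finset V}
    (hS : SupportedOn G S) (hc : #S ≤ 2) : PS G ≤ Nat.fib (#S + 1) :=
  (forest_of_card_le_two hS hc).PS_le hS

lemma PS_le_three [Fintype V] {G : SimpleGraph V} {S : Finset V} (hS : SupportedOn G S)
    (hc : #S = 3) {a : V} (haS : a ∈ S) (ha : dg G a ≤ 1) : PS G ≤ 3 := by
  rcases isolated_or_leaf hS haS hc ha with ⟨h1, h2⟩ | ⟨b, -, -, -, h1, h2, h3, h4, h5⟩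
  · have := PS_le_fib_of_card_le_two h1 h2.le
    rw [h2] at this
    exact this.trans (by decide)
  · have h6 := PS_le_fib_of_card_le_two h1 h2.le
    have h4' : #((S.erase a).erase b) = 1 := by omega
    have h7 := PS_le_fib_of_card_le_two h3 (by omega)
    rw [h2] at h6
    rw [h4'] at h7
    have : Nat.fib (2 + 1) = 2 := rfl
    have : Nat.fib (1 + 1) = 1 := rfl
    omega

lemma PS_le_three_of_le_cycle [Fintype V] {G H : SimpleGraph V} {S : Finset V}
    (hH : IsCycleOn H S) (hHS : SupportedOn H S) (hc : #S = 4) (hle : G ≤ H) {b : V}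
    (hb : b ∈ S) (hG : SupportedOn G (S.erase b)) : PS G ≤ 3 := by
  obtain ⟨c, hc'⟩ := dg_pos_iff.1 (show 0 < dg H b by rw [hH.dg_eq b hb]; omega)
  have hcS : c ∈ S.erase b := mem_erase.2 ⟨hc'.ne', hHS hc'.symm⟩
  refine PS_le_three hG (by rw [card_erase_of_mem hb, hc]) hcS ?_
  have hlt : dg G c < dg H c := by
    refine card_lt_card (ssubset_iff_of_subset ?_ |>.2 ⟨b, ?_, ?_⟩)
    · intro y hy
      rw [mem_filter_univ] at hy ⊢
      exact hle hy
    · simpa using hc'.symm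
    · rw [mem_filter_univ]
      exact fun h => (mem_erase.1 (hG h.symm)).1 rfl
  rw [hH.dg_eq c (mem_of_mem_erase hcS)] at hlt
  omega

/-- The sharp bound, for graphs with at most one cycle supported on `m + 3` vertices. The
`4`-cycle is the only exception. -/
def TadpoleBound [Fintype V] (G : SimpleGraph V) (S : Finset V) (m : ℕ) : Prop :=
  (m = 1 ∧ IsCycleOn G S ∧ PS G ≤ 9) ∨
    (PS G ≤ Nat.fib (m + 4) + 3 * Nat.fib (m + 1) ∧
      (PS G = Nat.fib (m + 4) + 3 * Nat.fib (m + 1) →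
        (∃ p, IsTadpole G S m p) ∧ edgeCount G = m + 3))

lemma TadpoleBound.PS_le [Fintype V] {G : SimpleGraph V} {S : Finset V} {m : ℕ}
    (h : TadpoleBound G S m) (hm : m ≠ 1) : PS G ≤ Nat.fib (m + 4) + 3 * Nat.fib (m + 1) := by
  rcases h with h | h
  · exact (hm h.1).elim
  · exact h.1

lemma TadpoleBound.PS_le_nine [Fintype V] {G : SimpleGraph V} {S : Finset V}
    (h : TadpoleBound G S 1) : PS G ≤ 9 := by
  rcases h with h | h
  · exact h.2.2
  · exact h.1.trans (by decide)

lemma tadpoleBound_of_leafless [Fintype V] {G : SimpleGraph V} {S : Finset V} {m : ℕ}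
    (hG : AtMostUnicyclic G) (hS : SupportedOn G S) (hc : #S = m + 3)
    (hd : ∀ x ∈ S, 2 ≤ dg G x) : TadpoleBound G S m := by
  obtain ⟨hC, hle⟩ := PS_cycle_le hG hS hd hc
  match m, hc, hle with
  | 0, hc, hle =>
    refine Or.inr ⟨hle, fun _ => ⟨?_, by rw [hC.edgeCount hS, hc]⟩⟩
    obtain ⟨b, hb⟩ := card_pos.1 (show 0 < #S by omega)
    have hadj : ∀ x ∈ S, ∀ y ∈ S, x ≠ y → G.Adj x y := fun x hx y hy hxy => by
      have : ({z | G.Adj x z} : Finset V) = S.erase x := by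
        refine eq_of_subset_of_card_le (fun z hz => ?_) ?_
        · rw [mem_filter_univ] at hz
          exact mem_erase.2 ⟨hz.ne', hS hz.symm⟩
        · have := hC.dg_eq x hx
          rw [dg] at this
          rw [this, card_erase_of_mem hx, hc]
      have hy' : y ∈ S.erase x := mem_erase.2 ⟨hxy.symm, hy⟩
      rw [← this] at hy'
      simpa using hy'
    obtain ⟨p, hp, -⟩ := IsTadpole.of_forall_adj hS hc hadj hb
    exact ⟨p, hp⟩
  | 1, hc, hle => exact Or.inl ⟨rfl, hC, hle⟩
  | k + 2, hc, hle =>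
    have hlt : PS G < Nat.fib (k + 2 + 4) + 3 * Nat.fib (k + 2 + 1) := by
      refine hle.trans_lt ?_
      have h1 := Nat.fib_add_two (n := k + 2)
      have h2 := Nat.fib_add_two (n := k + 1)
      have h3 : 0 < Nat.fib (k + 1) := Nat.fib_pos.2 (by omega)
      have h4 : 0 < Nat.fib (k + 2) := Nat.fib_pos.2 (by omega)
      simp only [Nat.add_assoc, Nat.reduceAdd] at h1 h2 ⊢
      omega
    exact Or.inr ⟨hlt.le, fun h => (hlt.ne h).elim⟩

lemma TadpoleBound.succ_of_erase [Fintype V] {G : SimpleGraph V} {S T : Finset V} {m : ℕ}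
    (h : TadpoleBound G T m) : TadpoleBound G S (m + 1) := by
  have hlt : PS G < Nat.fib (m + 1 + 4) + 3 * Nat.fib (m + 1 + 1) := by
    by_cases hm : m = 1
    · subst hm
      exact h.PS_le_nine.trans_lt (by decide)
    · refine (h.PS_le hm).trans_lt ?_
      have h1 := Nat.fib_add_two (n := m + 3)
      have h2 := Nat.fib_add_two (n := m)
      have h3 : 0 < Nat.fib (m + 3) := Nat.fib_pos.2 (by omega)
      simp only [Nat.add_assoc, Nat.reduceAdd] at h1 h2 ⊢
      omega
  exact Or.inr ⟨hlt.le, fun h => (hlt.ne h).elim⟩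

lemma tadpoleBound_of_leaf [Fintype V] {G : SimpleGraph V} {S : Finset V} {m : ℕ} {a b : V}
    (hS : SupportedOn G S) (hab : G.Adj a b) (ha : dg G a = 1)
    (hPS : PS G = PS (G.deleteEdges {s(a, b)}) + PS (isolate G a b))
    (hb : b ∈ S.erase a)
    (h1 : PS (G.deleteEdges {s(a, b)}) ≤ Nat.fib (m + 5) + 3 * Nat.fib (m + 2) ∧
      (PS (G.deleteEdges {s(a, b)}) = Nat.fib (m + 5) + 3 * Nat.fib (m + 2) →
        (∃ p, IsTadpole (G.deleteEdges {s(a, b)}) (S.erase a) (m + 1) p) ∧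
          edgeCount (G.deleteEdges {s(a, b)}) = m + 4))
    (h2 : PS (isolate G a b) ≤ Nat.fib (m + 4) + 3 * Nat.fib (m + 1) ∧
      (PS (isolate G a b) = Nat.fib (m + 4) + 3 * Nat.fib (m + 1) →
        edgeCount (isolate G a b) = m + 3)) :
    TadpoleBound G S (m + 2) := by
  have e1 := Nat.fib_add_two (n := m + 4)
  have e2 := Nat.fib_add_two (n := m + 1)
  simp only [Nat.add_assoc, Nat.reduceAdd] at e1 e2
  refine Or.inr ⟨?_, fun heq => ?_⟩
  · simp only [Nat.add_assoc, Nat.reduceAdd]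
    omega
  · simp only [Nat.add_assoc, Nat.reduceAdd] at heq
    obtain ⟨⟨p, hp⟩, hE⟩ := h1.2 (by omega)
    have hE' := h2.2 (by omega)
    have hE1 := edgeCount_isolate_add hab ha
    have hE2 := edgeCount_deleteEdges_add_one hab
    refine ⟨⟨_, hp.extend hS ?_ hab ha⟩, by omega⟩
    obtain ⟨i, hi, rfl⟩ := (hp.mem_iff b).1 hb
    by_contra hne
    have : i ≠ m + 1 + 2 := by rintro rfl; exact hne rfl
    have := hp.two_le_dg (i := i) (by omega)
    omega

lemma PS_le_twelve [Fintype V] {G H : SimpleGraph V} {S : Finset V} {b : V}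
    (hS : SupportedOn G S) (hc : #S = 5) (hb : b ∈ S) (hdb : dg G b ≤ 1)
    (hH : IsCycleOn H (S.erase b)) (hHS : SupportedOn H (S.erase b))
    (hHG : ∀ x y, G.Adj x y → x ≠ b → y ≠ b → H.Adj x y)
    (ih : ∀ K ≤ G, SupportedOn K (S.erase b) → PS K ≤ 9) : PS G ≤ 12 := by
  rcases isolated_or_leaf hS hb hc hdb with ⟨h1, h2⟩ | ⟨c, -, -, h0, h1, h2, h3, h4, h5⟩
  · have := ih G le_rfl h1
    omega
  · have h6 := ih _ (deleteEdges_le _) h1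
    have h7 := PS_le_three_of_le_cycle hH hHS h2
      (fun x y (h : (isolate G b c).Adj x y) => hHG x y h.1 h.2.1 h.2.2.2.1) h0 h3
    omega

theorem tadpoleBound [Fintype V] {G : SimpleGraph V} {S : Finset V} {m : ℕ}
    (hG : AtMostUnicyclic G) (hS : SupportedOn G S) (hc : #S = m + 3) : TadpoleBound G S m := by
  induction m using Nat.strong_induction_on generalizing G S with
  | _ m ih =>
  by_cases hd : ∀ x ∈ S, 2 ≤ dg G x
  · exact tadpoleBound_of_leafless hG hS hc hd
  push Not at hd
  obtain ⟨a, haS, ha⟩ := hd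
  rcases m with - | m
  · have := PS_le_three hS hc haS (by omega)
    have hlt : PS G < Nat.fib (0 + 4) + 3 * Nat.fib (0 + 1) := this.trans_lt (by decide)
    exact Or.inr ⟨hlt.le, fun h => (hlt.ne h).elim⟩
  rcases isolated_or_leaf hS haS hc (by omega) with ⟨h1, h2⟩ | ⟨b, hab, ha', hb, h1, h2, h3, h4, h5⟩
  · exact (ih m (by omega) hG h1 h2).succ_of_erase
  have ihH := ih m (by omega) (hG.deleteEdges {s(a, b)}) h1 h2
  rcases m with - | m
  · have h6 := ihH.PS_le (by omega)
    have h7 := PS_le_fib_of_card_le_two h3 (by omega)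
    have h4' : #((S.erase a).erase b) + 1 = 3 := by omega
    rw [h4'] at h7
    have e1 : Nat.fib (0 + 4) + 3 * Nat.fib (0 + 1) = 6 := rfl
    have e2 : Nat.fib (0 + 1 + 4) + 3 * Nat.fib (0 + 1 + 1) = 8 := rfl
    have e3 : Nat.fib 3 = 2 := rfl
    rw [TadpoleBound, e2]
    refine Or.inr ⟨by omega, fun heq => ?_⟩
    rcases ihH with hC | hT
    · omega
    obtain ⟨⟨p, hp⟩, hE⟩ := hT.2 (by rw [e1] at h6 ⊢; omega)
    obtain ⟨q, hq, hqb⟩ := IsTadpole.of_forall_adj h1 h2 hp.adj_of_ne hb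
    have hE2 := edgeCount_deleteEdges_add_one hab
    exact ⟨⟨_, hq.extend hS hqb hab ha'⟩, by omega⟩
  have ihI := ih m (by omega) (hG.isolate a b) h3 (by omega)
  rcases ihH with ⟨hm, hC, h9⟩ | hT
  · obtain rfl : m = 0 := by omega
    have hle : isolate G a b ≤ G.deleteEdges {s(a, b)} := fun x y h => by
      rw [deleteEdges_pair_adj]
      exact ⟨h.1, by have := h.2; tauto⟩
    have h6 := PS_le_three_of_le_cycle hC h1 h2 hle hb h3
    have hlt : PS G < Nat.fib (0 + 1 + 1 + 4) + 3 * Nat.fib (0 + 1 + 1 + 1) := by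
      refine (show PS G ≤ 12 by omega).trans_lt (by decide)
    exact Or.inr ⟨hlt.le, fun h => (hlt.ne h).elim⟩
  rcases ihI with ⟨hm, hC, h9⟩ | hT'
  · subst hm
    have h12 : PS (G.deleteEdges {s(a, b)}) ≤ 12 := by
      refine PS_le_twelve h1 h2 hb ?_ hC h3 ?_ ?_
      · have hE1 := edgeCount_isolate_add hab ha'
        have hE2 := (hG.deleteEdges {s(a, b)}).edgeCount_le h1
        have hE3 := hC.edgeCount h3
        omega
      · intro x y hxy hx hy
        exact ⟨hxy.1, (mem_erase.1 (h1 hxy)).1, hx, (mem_erase.1 (h1 hxy.symm)).1, hy⟩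
      · intro K hK hKS
        exact (ih 1 (by omega) ((hG.deleteEdges _).mono hK) hKS (by omega)).PS_le_nine
    have hlt : PS G < Nat.fib (1 + 1 + 1 + 4) + 3 * Nat.fib (1 + 1 + 1 + 1) := by
      refine (show PS G ≤ 21 by omega).trans_lt (by decide)
    exact Or.inr ⟨hlt.le, fun h => (hlt.ne h).elim⟩
  exact tadpoleBound_of_leaf hS hab ha' h5 hb hT ⟨hT'.1, fun h => (hT'.2 h).2⟩

lemma atMostUnicyclic_of_connected [Fintype V] {G : SimpleGraph V} (hconn : G.Connected)
    (hE : #G.edgeFinset ≤ Fintype.card V) : AtMostUnicyclic G := by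
  obtain ⟨T, hle, hT⟩ := hconn.exists_isTree_le
  have hF := forest_of_isAcyclic hT.isAcyclic
  have h1 := hT.card_edgeFinset
  have hsub : T.edgeFinset ⊆ G.edgeFinset := edgeFinset_mono hle
  have h2 := card_sdiff_add_card_eq_card hsub
  have h3 : #(G.edgeFinset \ T.edgeFinset) ≤ 1 := by omega
  have := hconn.nonempty
  obtain ⟨e, he⟩ : ∃ e, G.edgeFinset \ T.edgeFinset ⊆ {e} := by
    rcases Nat.le_one_iff_eq_zero_or_eq_one.1 h3 with h | h
    · exact ⟨s(this.some, this.some), by rw [card_eq_zero.1 h]; exact empty_subset _⟩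
    · obtain ⟨e, he⟩ := card_eq_one.1 h
      exact ⟨e, he.subset⟩
  induction e with
  | h a b =>
  refine ⟨a, b, hF.mono fun x y hxy => ?_⟩
  by_contra hTxy
  have := he (mem_sdiff.2 ⟨mem_edgeFinset.2 hxy.1,
    fun h => hTxy ((mem_edgeSet T).1 (mem_edgeFinset.1 h))⟩)
  rw [deleteEdges_adj] at hxy
  exact hxy.2 (by simpa using this)

lemma D3_adj {m : ℕ} (i j : Fin (m + 3)) : (D3 m).Adj i j ↔ TadpoleAdj i j := by
  have h2 : ((2 : Fin (m + 3)) : ℕ) = 2 := Fin.val_two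
  simp only [D3, sup_adj, pathGraph_adj, fromEdgeSet_adj, Set.mem_singleton_iff, Sym2.eq_iff,
    TadpoleAdj, Fin.ext_iff, h2, Fin.val_zero, ne_eq]
  omega

lemma nonempty_iso_D3_iff [Fintype V] {G : SimpleGraph V} {m : ℕ} :
    Nonempty (G ≃g D3 m) ↔ ∃ p, IsTadpole G univ m p := by
  constructor
  · rintro ⟨e⟩
    have hp : ∀ i, (hi : i < m + 3) → e.symm (Fin.ofNat (m + 3) i) = e.symm ⟨i, hi⟩ := by
      intro i hi
      have : Fin.ofNat (m + 3) i = ⟨i, hi⟩ := Fin.ext (Nat.mod_eq_of_lt hi)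
      rw [this]
    refine ⟨fun i => e.symm (Fin.ofNat (m + 3) i), fun _ _ _ => mem_univ _,
      fun i hi j hj hij => ?_, fun x => ?_, fun i hi j hj => ?_⟩
    · rw [hp i hi, hp j hj] at hij
      simpa using e.symm.injective hij
    · refine iff_of_true (mem_univ _) ⟨e x, (e x).2, ?_⟩
      rw [hp _ (e x).2]
      exact e.symm_apply_apply x
    · rw [hp i hi, hp j hj, e.symm.map_adj_iff, D3_adj]
  · rintro ⟨p, hp⟩
    refine ⟨RelIso.symm ⟨Equiv.ofBijective (fun i : Fin (m + 3) => p i)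
      ⟨fun i j hij => Fin.ext (hp.inj i i.2 j j.2 hij), fun x => ?_⟩, ?_⟩⟩
    · obtain ⟨i, hi, hx⟩ := (hp.mem_iff x).1 (mem_univ x)
      exact ⟨⟨i, hi⟩, hx⟩
    · intro i j
      rw [D3_adj]
      exact hp.adj i i.2 j j.2

/-- A unicyclic graph on `n ≥ 5` vertices has permanental sum at most `6·F(n-2) + 2·F(n-3)`,
with equality iff it is `D(3, n-3)`. -/
theorem PS_unicyclic_le [Fintype V] (G : SimpleGraph V) (n : ℕ) (hcard : Fintype.card V = n)
    (hn : 5 ≤ n) (hconn : G.Connected) (hedges : G.edgeFinset.card = n) :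
    PS G ≤ 6 * Nat.fib (n - 2) + 2 * Nat.fib (n - 3) ∧
    (PS G = 6 * Nat.fib (n - 2) + 2 * Nat.fib (n - 3) ↔
      Nonempty (G ≃g D3 (n - 3))) := by
  obtain ⟨k, rfl⟩ : ∃ k, n = k + 5 := ⟨n - 5, by omega⟩
  have hval : 6 * Nat.fib (k + 5 - 2) + 2 * Nat.fib (k + 5 - 3) =
      Nat.fib (k + 2 + 4) + 3 * Nat.fib (k + 2 + 1) := by
    have h1 := Nat.fib_add_two (n := k + 4)
    have h2 := Nat.fib_add_two (n := k + 3)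
    have h3 := Nat.fib_add_two (n := k + 2)
    simp only [Nat.add_assoc, Nat.reduceAdd, Nat.reduceSubDiff] at h1 h2 h3 ⊢
    omega
  have hB := tadpoleBound (m := k + 2) (atMostUnicyclic_of_connected hconn (by omega))
    (S := univ) (fun _ _ _ => mem_univ _) (by rw [card_univ]; omega)
  rw [hval, show k + 5 - 3 = k + 2 by omega, nonempty_iso_D3_iff]
  rcases hB with hB | hB
  · omega
  · exact ⟨hB.1, fun h => (hB.2 h).1, fun ⟨p, hp⟩ => hp.PS_eq⟩

end PermSum
end
end

section
/- Let H be a forest with m ≥ 1 vertices and U a unicyclic graph with t ≥ 3 vertices, where n = m + t ≥ 7. Then PS(H ⊔ U) ≤ 6·F(n−2), with equality if and only if H ⊔ U ≅ P_{n−3} ⊔ C_3. -/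
open SimpleGraph Finset
open scoped Classical

noncomputable section

namespace PermSum

variable {V W : Type*}

/-- Every nonempty set of vertices contains a vertex with at most one neighbour in the set. -/
def IsOneDegenerate (G : SimpleGraph V) : Prop :=
  ∀ S : Finset V, S.Nonempty →
    ∃ v ∈ S, ∀ a ∈ S, ∀ b ∈ S, G.Adj v a → G.Adj v b → a = b

lemma IsOneDegenerate.anti {G G' : SimpleGraph V} (h : IsOneDegenerate G') (hle : G ≤ G') :
    IsOneDegenerate G := fun S hS ↦ by
  obtain ⟨v, hv, h⟩ := h S hS
  exact ⟨v, hv, fun a ha b hb hva hvb ↦ h a ha b hb (hle hva) (hle hvb)⟩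

lemma IsOneDegenerate.of_isAcyclic {G : SimpleGraph V} (hG : G.IsAcyclic) :
    IsOneDegenerate G := fun S hS ↦ by
  have : Nonempty (S : Set V) := hS.to_subtype
  obtain ⟨u, v, p, hp, hmax⟩ :=
    Walk.exists_isPath_forall_isPath_length_le_length (G.induce (S : Set V))
  have hac : (G.induce (S : Set V)).IsAcyclic := hG.induce _
  have key : ∀ a (ha : a ∈ S), G.Adj u a → (⟨a, ha⟩ : (S : Set V)) = p.snd := by
    intro a ha hua
    have hadj : (G.induce (S : Set V)).Adj u ⟨a, ha⟩ := hua
    refine hac.eq_snd_of_adj_start hp hadj ?_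
    by_contra hns
    have := hmax _ _ _ (hp.cons (h := hadj.symm) hns)
    simp at this
  refine ⟨u, u.2, fun a ha b hb hua hub ↦ ?_⟩
  exact congrArg Subtype.val ((key a ha hua).trans (key b hb hub).symm)

lemma IsOneDegenerate.sum {G : SimpleGraph V} {H : SimpleGraph W} (hG : IsOneDegenerate G)
    (hH : IsOneDegenerate H) : IsOneDegenerate (G ⊕g H) := fun S hS ↦ by
  by_cases hne : (S.preimage Sum.inl Sum.inl_injective.injOn).Nonempty
  · obtain ⟨v, hv, h⟩ := hG _ hne
    refine ⟨.inl v, by simpa using hv, ?_⟩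
    rintro (a | a) ha (b | b) hb hva hvb
    · simp_all only [Finset.mem_preimage, sum_adj_inl, Sum.inl.injEq]
      exact h a ha b hb hva hvb
    all_goals simp at hva hvb
  · have hne' : (S.preimage Sum.inr Sum.inr_injective.injOn).Nonempty := by
      obtain ⟨x | x, hx⟩ := hS
      · exact absurd ⟨x, by simpa using hx⟩ hne
      · exact ⟨x, by simpa using hx⟩
    obtain ⟨v, hv, h⟩ := hH _ hne'
    refine ⟨.inr v, by simpa using hv, ?_⟩
    rintro (a | a) ha (b | b) hb hva hvb
    any_goals simp at hva hvb
    simp_all only [Finset.mem_preimage, Sum.inr.injEq]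
    exact h a ha b hb hva hvb

lemma IsOneDegenerate.not_adj_of_isChain {G : SimpleGraph V} (hG : IsOneDegenerate G)
    {l : List V} (hl : l.Nodup) (hc : l.IsChain G.Adj) {i j : ℕ} (hij : i + 1 < j)
    (hj : j < l.length) : ¬ G.Adj l[i] l[j] := by
  intro hadj
  rw [List.isChain_iff_getElem] at hc
  have hinj : ∀ a b (ha : a < l.length) (hb : b < l.length), l[a] = l[b] → a = b :=
    fun a b ha hb h ↦ (hl.getElem_inj_iff).1 h
  let S : Finset V := (Finset.Icc i j).attach.image fun k : {x // x ∈ Finset.Icc i j} ↦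
    l[(k : ℕ)]'((Finset.mem_Icc.1 k.2).2.trans_lt hj)
  have hS : ∀ k (h1 : i ≤ k) (h2 : k ≤ j), l[k] ∈ S := fun k h1 h2 ↦
    Finset.mem_image.2 ⟨⟨k, Finset.mem_Icc.2 ⟨h1, h2⟩⟩, Finset.mem_attach _ _, rfl⟩
  obtain ⟨v, hv, h⟩ := hG S ⟨_, hS i le_rfl (by omega)⟩
  obtain ⟨⟨k, hk⟩, -, rfl⟩ := Finset.mem_image.1 hv
  rw [Finset.mem_Icc] at hk
  obtain ⟨h1, h2⟩ := hk
  dsimp only at h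
  rcases h1.eq_or_lt with rfl | h1'
  · have := hinj _ _ _ _ (h _ (hS (i + 1) (by omega) (by omega)) _ (hS j (by omega) le_rfl)
      (hc i (by omega)) hadj)
    omega
  rcases h2.eq_or_lt with rfl | h2'
  · have hp := hc (k - 1) (by omega)
    simp only [Nat.sub_add_cancel (show 1 ≤ k by omega)] at hp
    have := hinj _ _ _ _ (h _ (hS (k - 1) (by omega) (by omega)) _ (hS i le_rfl (by omega))
      hp.symm hadj.symm)
    omega
  · have hp := hc (k - 1) (by omega)
    simp only [Nat.sub_add_cancel (show 1 ≤ k by omega)] at hp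
    have := hinj _ _ _ _ (h _ (hS (k - 1) (by omega) (by omega)) _
      (hS (k + 1) (by omega) (by omega)) hp.symm (hc k (by omega)))
    omega

/-- The matchings of `G`, as sets of edges, all of whose vertices lie in `S`. -/
def matchingsIn [Fintype V] (G : SimpleGraph V) (S : Finset V) : Finset (Finset (Sym2 V)) :=
  Finset.univ.filter fun M ↦ (∀ e ∈ M, e ∈ G.edgeSet) ∧ (∀ e ∈ M, ∀ x ∈ e, x ∈ S) ∧
    ∀ e ∈ M, ∀ f ∈ M, ∀ x, x ∈ e → x ∈ f → e = f

/-- The number of matchings of the subgraph of `G` induced by `S`. -/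
def matchingCount [Fintype V] (G : SimpleGraph V) (S : Finset V) : ℕ := #(matchingsIn G S)

section

variable [Fintype V] {G : SimpleGraph V} {S R : Finset V} {M : Finset (Sym2 V)}

lemma mem_matchingsIn : M ∈ matchingsIn G S ↔ (∀ e ∈ M, e ∈ G.edgeSet) ∧
    (∀ e ∈ M, ∀ x ∈ e, x ∈ S) ∧ ∀ e ∈ M, ∀ f ∈ M, ∀ x, x ∈ e → x ∈ f → e = f := by
  simp [matchingsIn]

lemma matchingsIn_mono {S T : Finset V} (h : S ⊆ T) : matchingsIn G S ⊆ matchingsIn G T := by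
  intro M hM
  rw [mem_matchingsIn] at hM ⊢
  exact ⟨hM.1, fun e he x hx ↦ h (hM.2.1 e he x hx), hM.2.2⟩

lemma matchingCount_empty : matchingCount G ∅ = 1 := by
  rw [matchingCount, Finset.card_eq_one]
  refine ⟨∅, ?_⟩
  ext M
  rw [mem_matchingsIn, Finset.mem_singleton]
  constructor
  · rintro ⟨-, h, -⟩
    refine Finset.eq_empty_of_forall_notMem fun e he ↦ ?_
    induction e with | _ a b
    exact absurd (h _ he a (by simp)) (by simp)
  · rintro rfl
    simp

lemma matchingCount_pos : 0 < matchingCount G S :=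
  Finset.card_pos.2 ⟨∅, by simp [mem_matchingsIn]⟩

lemma matchingsIn_insert (v : V) (hv : v ∉ S) :
    matchingsIn G (insert v S) = matchingsIn G S ∪ (S.filter (G.Adj v)).biUnion fun u ↦
      (matchingsIn G (S.erase u)).image (insert s(v, u)) := by
  ext M
  simp only [Finset.mem_union, Finset.mem_biUnion, Finset.mem_image, Finset.mem_filter]
  constructor
  · intro hM
    rw [mem_matchingsIn] at hM
    obtain ⟨h1, h2, h3⟩ := hM
    by_cases hvM : ∃ e ∈ M, v ∈ e
    · right
      obtain ⟨e, he, hve⟩ := hvM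
      obtain ⟨u, rfl⟩ := hve
      have hadj : G.Adj v u := h1 _ he
      have hu := h2 _ he u (by simp)
      refine ⟨u, ⟨(Finset.mem_insert.1 hu).resolve_left hadj.ne', hadj⟩, M.erase s(v, u), ?_,
        Finset.insert_erase he⟩
      rw [mem_matchingsIn]
      refine ⟨fun e he' ↦ h1 e (Finset.mem_of_mem_erase he'), fun e he' x hx ↦ ?_,
        fun e he f hf ↦ h3 e (Finset.mem_of_mem_erase he) f (Finset.mem_of_mem_erase hf)⟩
      obtain ⟨hne, he'⟩ := Finset.mem_erase.1 he'
      rw [Finset.mem_erase]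
      refine ⟨?_, (Finset.mem_insert.1 (h2 e he' x hx)).resolve_left ?_⟩
      · rintro rfl
        exact hne (h3 _ (Finset.mem_of_mem_erase he') _ he x hx (by simp))
      · rintro rfl
        exact hne (h3 _ (Finset.mem_of_mem_erase he') _ he x hx (by simp))
    · left
      push Not at hvM
      rw [mem_matchingsIn]
      exact ⟨h1, fun e he x hx ↦ (Finset.mem_insert.1 (h2 e he x hx)).resolve_left
        (fun h ↦ hvM e he (h ▸ hx)), h3⟩
  · rintro (hM | ⟨u, ⟨hu, hadj⟩, M, hM, rfl⟩)
    · exact matchingsIn_mono (Finset.subset_insert _ _) hM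
    · rw [mem_matchingsIn] at hM ⊢
      obtain ⟨h1, h2, h3⟩ := hM
      have key : ∀ f ∈ M, ∀ x, x ∈ s(v, u) → x ∉ f := by
        intro f hf x hx hxf
        have := h2 f hf x hxf
        rw [Finset.mem_erase] at this
        rcases Sym2.mem_iff.1 hx with rfl | rfl
        · exact hv this.2
        · exact this.1 rfl
      refine ⟨?_, ?_, ?_⟩
      · intro e he
        rcases Finset.mem_insert.1 he with rfl | he
        · exact hadj
        · exact h1 e he
      · intro e he x hx
        rcases Finset.mem_insert.1 he with rfl | he
        · rcases Sym2.mem_iff.1 hx with rfl | rfl <;> simp [hu]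
        · exact Finset.mem_insert_of_mem (Finset.mem_of_mem_erase (h2 e he x hx))
      · intro e he f hf x hxe hxf
        rcases Finset.mem_insert.1 he with rfl | he <;>
          rcases Finset.mem_insert.1 hf with rfl | hf
        · rfl
        · exact absurd hxf (key f hf x hxe)
        · exact absurd hxe (key e he x hxf)
        · exact h3 e he f hf x hxe hxf

lemma matchingCount_insert (v : V) (hv : v ∉ S) :
    matchingCount G (insert v S) =
      matchingCount G S + ∑ u ∈ S.filter (G.Adj v), matchingCount G (S.erase u) := by
  have hnot : ∀ (T : Finset V), v ∉ T → ∀ M ∈ matchingsIn G T, ∀ u, s(v, u) ∉ M := by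
    intro T hT M hM u hu
    exact hT ((mem_matchingsIn.1 hM).2.1 _ hu v (by simp))
  have hverase : ∀ u, v ∉ S.erase u := fun u h ↦ hv (Finset.mem_of_mem_erase h)
  rw [matchingCount, matchingsIn_insert v hv, Finset.card_union_of_disjoint,
    Finset.card_biUnion]
  · congr 1
    refine Finset.sum_congr rfl fun u _ ↦ Finset.card_image_of_injOn ?_
    intro M hM N hN h
    rw [← Finset.erase_insert (hnot _ (hverase u) M hM u),
      ← Finset.erase_insert (hnot _ (hverase u) N hN u)]
    exact congrArg (fun Q ↦ Finset.erase Q s(v, u)) h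
  · intro u _ w _ huw
    refine Finset.disjoint_left.2 ?_
    intro M hM hM'
    obtain ⟨N, hN, rfl⟩ := Finset.mem_image.1 hM
    obtain ⟨N', hN', h⟩ := Finset.mem_image.1 hM'
    have : s(v, w) ∈ insert s(v, u) N := h ▸ Finset.mem_insert_self _ _
    rcases Finset.mem_insert.1 this with h | h
    · exact huw (Sym2.congr_right.1 h).symm
    · exact hnot _ (hverase u) N hN w h
  · rw [Finset.disjoint_left]
    intro M hM hM'
    obtain ⟨u, -, h⟩ := Finset.mem_biUnion.1 hM'
    obtain ⟨N, -, rfl⟩ := Finset.mem_image.1 h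
    exact hnot S hv _ hM u (Finset.mem_insert_self _ _)

lemma matchingCount_insert_leaf {v u : V} (hv : v ∉ S) (hu : u ∈ S) (hadj : G.Adj v u)
    (huniq : ∀ w ∈ S, G.Adj v w → w = u) :
    matchingCount G (insert v S) = matchingCount G S + matchingCount G (S.erase u) := by
  have : S.filter (G.Adj v) = {u} := by
    ext w
    simp only [Finset.mem_filter, Finset.mem_singleton]
    exact ⟨fun h ↦ huniq w h.1 h.2, fun h ↦ h ▸ ⟨hu, hadj⟩⟩
  rw [matchingCount_insert v hv, this, Finset.sum_singleton]

lemma matchingCount_insert_isolated {v : V} (hv : v ∉ S) (h : ∀ w ∈ S, ¬ G.Adj v w) :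
    matchingCount G (insert v S) = matchingCount G S := by
  rw [matchingCount_insert v hv, Finset.filter_false_of_mem h, Finset.sum_empty, add_zero]

lemma fib_length_le_matchingCount : ∀ {l : List V}, l.Nodup → l.IsChain G.Adj →
    Nat.fib (l.length + 1) ≤ matchingCount G l.toFinset
  | [], _, _ => by simp [matchingCount_empty]
  | [x], _, _ => by simpa using Nat.one_le_iff_ne_zero.2 matchingCount_pos.ne'
  | x :: y :: l, hl, hc => by
    have hx : x ∉ (y :: l).toFinset := by simpa using (List.nodup_cons.1 hl).1
    have hy : y ∉ l.toFinset := by simpa using (List.nodup_cons.1 (List.nodup_cons.1 hl).2).1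
    have h1 := fib_length_le_matchingCount (List.nodup_cons.1 hl).2 hc.tail
    have h2 := fib_length_le_matchingCount (List.nodup_cons.1 (List.nodup_cons.1 hl).2).2
      hc.tail.tail
    have hadj : G.Adj x y := by simpa using (List.isChain_cons_cons.1 hc).1
    rw [List.toFinset_cons, matchingCount_insert x hx]
    have hmem : y ∈ (y :: l).toFinset.filter (G.Adj x) := by simp [hadj]
    have h3 := Finset.single_le_sum
      (f := fun u ↦ matchingCount G ((y :: l).toFinset.erase u)) (fun _ _ ↦ Nat.zero_le _) hmem
    have h4 : (y :: l).toFinset.erase y = l.toFinset := by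
      rw [List.toFinset_cons, Finset.erase_insert hy]
    simp only [h4] at h3
    simp only [List.length_cons] at h1 ⊢
    rw [Nat.fib_add_two (n := l.length + 1)]
    omega

lemma matchingCount_union_le (hG : IsOneDegenerate G) (hd : Disjoint S R)
    (hSR : ∀ a ∈ S, ∀ b ∈ R, ¬ G.Adj a b) :
    matchingCount G (S ∪ R) ≤ Nat.fib (#S + 1) * matchingCount G R := by
  induction hn : #S using Nat.strong_induction_on generalizing S with
  | _ n ih =>
  subst hn
  rcases S.eq_empty_or_nonempty with rfl | hne
  · simp
  obtain ⟨v, hv, hleaf⟩ := hG S hne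
  have step : ∀ T ⊆ S, #T < #S →
      matchingCount G (T ∪ R) ≤ Nat.fib (#T + 1) * matchingCount G R := fun T hT hlt ↦
    ih _ hlt (Finset.disjoint_of_subset_left hT hd) (fun a ha ↦ hSR a (hT ha)) rfl
  have hcard := Finset.card_erase_add_one hv
  have h1 := step (S.erase v) (Finset.erase_subset _ _) (by omega)
  have hvR : v ∉ R := Finset.disjoint_left.1 hd hv
  have hvn : v ∉ S.erase v ∪ R := by simp [hvR]
  have hSe : S ∪ R = insert v (S.erase v ∪ R) := by
    rw [← Finset.insert_union, Finset.insert_erase hv]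
  by_cases hex : ∃ u ∈ S, G.Adj v u
  · obtain ⟨u, hu, hadj⟩ := hex
    have huS : u ∈ S.erase v := Finset.mem_erase.2 ⟨hadj.ne', hu⟩
    have hcard' := Finset.card_erase_add_one huS
    have h2 := step ((S.erase v).erase u)
      ((Finset.erase_subset _ _).trans (Finset.erase_subset _ _)) (by omega)
    rw [hSe, matchingCount_insert_leaf hvn (Finset.mem_union_left _ huS) hadj]
    · rw [Finset.erase_union_distrib, Finset.erase_eq_of_notMem
        (Finset.disjoint_left.1 hd hu)]
      have hfib : Nat.fib (#S + 1) = Nat.fib (#((S.erase v).erase u) + 1)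
          + Nat.fib (#(S.erase v) + 1) := by
        rw [← hcard, ← hcard', Nat.fib_add_two]
      rw [hfib, add_mul]
      omega
    · intro w hw hvw
      rcases Finset.mem_union.1 hw with hw | hw
      · exact hleaf w (Finset.mem_of_mem_erase hw) u hu hvw hadj
      · exact absurd hvw (hSR v hv w hw)
  · push Not at hex
    rw [hSe, matchingCount_insert_isolated hvn]
    · refine h1.trans (Nat.mul_le_mul_right _ (Nat.fib_mono (by omega)))
    · intro w hw hvw
      rcases Finset.mem_union.1 hw with hw | hw
      · exact hex w (Finset.mem_of_mem_erase hw) hvw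
      · exact hSR v hv w hw hvw

lemma matchingCount_le (hG : IsOneDegenerate G) : matchingCount G S ≤ Nat.fib (#S + 1) := by
  simpa [matchingCount_empty] using
    matchingCount_union_le (S := S) (R := ∅) hG (Finset.disjoint_empty_right _) (by simp)

/-- A vertex set attaining the Fibonacci bound can be listed as a path. -/
lemma exists_isChain_of_matchingCount_union_eq (hG : IsOneDegenerate G) (hd : Disjoint S R)
    (hSR : ∀ a ∈ S, ∀ b ∈ R, ¬ G.Adj a b)
    (heq : matchingCount G (S ∪ R) = Nat.fib (#S + 1) * matchingCount G R) :
    ∃ l : List V, l.Nodup ∧ l.toFinset = S ∧ l.IsChain G.Adj := by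
  induction hn : #S using Nat.strong_induction_on generalizing S with
  | _ n ih =>
  subst hn
  rcases S.eq_empty_or_nonempty with rfl | hne
  · exact ⟨[], by simp⟩
  obtain ⟨v, hv, hleaf⟩ := hG S hne
  have hsub : ∀ T ⊆ S, Disjoint T R ∧ ∀ a ∈ T, ∀ b ∈ R, ¬ G.Adj a b := fun T hT ↦
    ⟨Finset.disjoint_of_subset_left hT hd, fun a ha ↦ hSR a (hT ha)⟩
  have hR := matchingCount_pos (G := G) (S := R)
  have hcard := Finset.card_erase_add_one hv
  obtain ⟨hd1, hSR1⟩ := hsub (S.erase v) (Finset.erase_subset _ _)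
  have h1 := matchingCount_union_le hG hd1 hSR1
  have hvR : v ∉ R := Finset.disjoint_left.1 hd hv
  have hvn : v ∉ S.erase v ∪ R := by simp [hvR]
  have hSe : S ∪ R = insert v (S.erase v ∪ R) := by
    rw [← Finset.insert_union, Finset.insert_erase hv]
  by_cases hex : ∃ u ∈ S, G.Adj v u
  · obtain ⟨u, hu, hadj⟩ := hex
    have huS : u ∈ S.erase v := Finset.mem_erase.2 ⟨hadj.ne', hu⟩
    have hcard' := Finset.card_erase_add_one huS
    obtain ⟨hd2, hSR2⟩ := hsub ((S.erase v).erase u)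
      ((Finset.erase_subset _ _).trans (Finset.erase_subset _ _))
    have h2 := matchingCount_union_le hG hd2 hSR2
    rw [hSe, matchingCount_insert_leaf hvn (Finset.mem_union_left _ huS) hadj,
      Finset.erase_union_distrib, Finset.erase_eq_of_notMem (Finset.disjoint_left.1 hd hu)] at heq
    · have hfib : Nat.fib (#S + 1) = Nat.fib (#((S.erase v).erase u) + 1)
          + Nat.fib (#(S.erase v) + 1) := by
        rw [← hcard, ← hcard', Nat.fib_add_two]
      rw [hfib, add_mul] at heq
      obtain ⟨l, hnd, hl, hc⟩ := ih _ (by omega) hd1 hSR1 (by omega) rfl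
      have heq2 : matchingCount G ((S.erase v).erase u ∪ R) =
        Nat.fib (#((S.erase v).erase u) + 1) * matchingCount G R := by omega
      have hul : u ∈ l := by rw [← List.mem_toFinset, hl]; exact huS
      have hvl : v ∉ l := by rw [← List.mem_toFinset, hl]; simp
      obtain ⟨l₁, l₂, rfl⟩ := List.append_of_mem hul
      rcases eq_or_ne l₁ [] with rfl | hl₁
      · refine ⟨v :: u :: l₂, List.nodup_cons.2 ⟨hvl, hnd⟩, ?_, ?_⟩
        · rw [List.toFinset_cons]
          exact (congrArg (insert v) hl).trans (Finset.insert_erase hv)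
        · exact List.isChain_cons_cons.2 ⟨hadj, hc⟩
      rcases eq_or_ne l₂ [] with rfl | hl₂
      · refine ⟨l₁ ++ [u] ++ [v], ?_, ?_, ?_⟩
        · grind
        · rw [List.toFinset_append, hl]
          ext w
          simp only [Finset.mem_union, Finset.mem_erase, List.mem_toFinset, List.mem_singleton]
          grind
        · refine List.IsChain.append hc (by simp) ?_
          simp [hadj.symm]
      exfalso
      have hnd' := hnd
      rw [List.nodup_append, List.nodup_cons] at hnd'
      obtain ⟨hnd₁, ⟨hu₂, hnd₂⟩, hdis⟩ := hnd'
      have hu₁ : u ∉ l₁ := fun h ↦ hdis u h u (by simp) rfl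
      have hset : (S.erase v).erase u = l₁.toFinset ∪ l₂.toFinset := by
        rw [← hl]
        ext w
        simp only [Finset.mem_union, Finset.mem_erase, List.mem_toFinset, List.mem_append,
          List.mem_cons]
        grind
      have hdis' : Disjoint l₁.toFinset l₂.toFinset := by
        rw [Finset.disjoint_left]
        intro w hw₁ hw₂
        rw [List.mem_toFinset] at hw₁ hw₂
        exact hdis w hw₁ w (by simp [hw₂]) rfl
      rw [hset] at hd2 hSR2 heq2
      rw [Finset.disjoint_union_left] at hd2
      have hcross : ∀ a ∈ l₁.toFinset, ∀ b ∈ l₂.toFinset, ¬ G.Adj a b := by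
        intro a ha b hb
        rw [List.mem_toFinset] at ha hb
        obtain ⟨i, hi, rfl⟩ := List.mem_iff_getElem.1 ha
        obtain ⟨j, hj, rfl⟩ := List.mem_iff_getElem.1 hb
        have := hG.not_adj_of_isChain hnd hc (i := i) (j := l₁.length + 1 + j) (by omega)
          (by simp; omega)
        rw [List.getElem_append_left hi, List.getElem_append_right (by omega)] at this
        simpa [show l₁.length + 1 + j - l₁.length = j + 1 by omega] using this
      have h3 := matchingCount_union_le (S := l₁.toFinset) (R := l₂.toFinset ∪ R) hG
        (Finset.disjoint_union_right.2 ⟨hdis', hd2.1⟩) (by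
          intro a ha b hb
          rcases Finset.mem_union.1 hb with hb | hb
          · exact hcross a ha b hb
          · exact hSR2 a (Finset.mem_union_left _ ha) b hb)
      have h4 := matchingCount_union_le (S := l₂.toFinset) (R := R) hG hd2.2
        (fun a ha ↦ hSR2 a (Finset.mem_union_right _ ha))
      have h5 := h3.trans (Nat.mul_le_mul_left _ h4)
      rw [← Finset.union_assoc, heq2, Finset.card_union_of_disjoint hdis', ← mul_assoc] at h5
      have h6 := Nat.le_of_mul_le_mul_right h5 hR
      rw [Nat.fib_add] at h6
      have hpos : 0 < Nat.fib #l₁.toFinset * Nat.fib #l₂.toFinset :=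
        Nat.mul_pos (Nat.fib_pos.2 (Finset.card_pos.2 (by simpa using hl₁)))
          (Nat.fib_pos.2 (Finset.card_pos.2 (by simpa using hl₂)))
      omega
    · intro w hw hvw
      rcases Finset.mem_union.1 hw with hw | hw
      · exact hleaf w (Finset.mem_of_mem_erase hw) u hu hvw hadj
      · exact absurd hvw (hSR v hv w hw)
  · push Not at hex
    rw [hSe, matchingCount_insert_isolated hvn] at heq
    · have hle : Nat.fib (#S + 1) ≤ Nat.fib #S := by
        rw [← hcard] at heq ⊢
        exact Nat.le_of_mul_le_mul_right (heq ▸ h1) hR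
      have hS1 : #S = 1 := by
        by_contra hne1
        have := hne.card_pos
        exact absurd (Nat.fib_lt_fib_succ (by omega : 2 ≤ #S)) (by omega)
      obtain ⟨w, rfl⟩ := Finset.card_eq_one.1 hS1
      exact ⟨[w], by simp⟩
    · intro w hw hvw
      rcases Finset.mem_union.1 hw with hw | hw
      · exact hex w (Finset.mem_of_mem_erase hw) hvw
      · exact hSR v hv w hw hvw

end

section

lemma degree_eq_two_iff {T : SimpleGraph V} {v : V} [Fintype (T.neighborSet v)] :
    T.degree v = 2 ↔ ∃ a b, a ≠ b ∧ ∀ w, T.Adj v w ↔ w = a ∨ w = b := by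
  rw [← card_neighborFinset_eq_degree, Finset.card_eq_two]
  simp [Finset.ext_iff]

lemma eq_of_degree_le_one {T : SimpleGraph V} {v a b : V} [Fintype (T.neighborSet v)]
    (h : T.degree v ≤ 1) (ha : T.Adj v a) (hb : T.Adj v b) : a = b := by
  rw [← card_neighborFinset_eq_degree, Finset.card_le_one] at h
  exact h a (by simpa) b (by simpa)

lemma degree_eq_one_of_adj {T : SimpleGraph V} {v a : V} [Fintype (T.neighborSet v)]
    (h : ∀ b c, T.Adj v b → T.Adj v c → b = c) (ha : T.Adj v a) : T.degree v = 1 := by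
  rw [← card_neighborFinset_eq_degree, Finset.card_eq_one]
  refine ⟨a, Finset.ext fun w ↦ ?_⟩
  rw [mem_neighborFinset, Finset.mem_singleton]
  exact ⟨fun hw ↦ h _ _ hw ha, fun hw ↦ hw ▸ ha⟩

variable [Fintype V] {G : SimpleGraph V} {M : Finset (Sym2 V)}

lemma IsSachs.adj_iff (hM : IsSachs G M) {a b : V} :
    (fromEdgeSet (M : Set (Sym2 V))).Adj a b ↔ s(a, b) ∈ M := by
  rw [fromEdgeSet_adj, Finset.mem_coe, and_iff_left_iff_imp]
  exact fun h ↦ (show G.Adj a b from hM.1 h).ne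

lemma IsSachs.degree_eq_two_of_adj (hM : IsSachs G M) {v w : V}
    (hv : (fromEdgeSet (M : Set (Sym2 V))).degree v = 2)
    (hvw : (fromEdgeSet (M : Set (Sym2 V))).Adj v w) :
    (fromEdgeSet (M : Set (Sym2 V))).degree w = 2 := by
  refine (hM.2.1 w ⟨v, hvw.symm⟩).resolve_left fun h ↦ ?_
  have := hM.2.2 w v hvw.symm h
  omega

lemma IsSachs.mem_matchingsIn (hM : IsSachs G M) {S : Finset V}
    (h : ∀ v ∈ S, (fromEdgeSet (M : Set (Sym2 V))).degree v ≠ 2) {N : Finset (Sym2 V)}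
    (hN : N ⊆ M) (hNS : ∀ e ∈ N, ∀ x ∈ e, x ∈ S) : N ∈ matchingsIn G S := by
  rw [PermSum.mem_matchingsIn]
  refine ⟨fun e he ↦ hM.1 (hN he), hNS, ?_⟩
  rintro e he f hf x ⟨a, rfl⟩ ⟨b, rfl⟩
  have ha := hM.adj_iff.2 (hN he)
  have hb := hM.adj_iff.2 (hN hf)
  have hdeg := (hM.2.1 x ⟨a, ha⟩).resolve_right (h x (hNS _ he x (by simp)))
  rw [eq_of_degree_le_one hdeg.le ha hb]

/-- In a Sachs subgraph, a set of vertices closed under adjacency whose incident edges lie in a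
1-degenerate graph contains no vertex of degree two. -/
lemma IsSachs.degree_ne_two (hM : IsSachs G M) {G' : SimpleGraph V} (hG' : IsOneDegenerate G')
    {S : Finset V} (hS : ∀ v ∈ S, ∀ w, s(v, w) ∈ M → w ∈ S ∧ G'.Adj v w) :
    ∀ v ∈ S, (fromEdgeSet (M : Set (Sym2 V))).degree v ≠ 2 := by
  intro v₀ hv₀ hdeg
  obtain ⟨v, hv, h⟩ := hG' (S.filter fun v ↦ (fromEdgeSet (M : Set (Sym2 V))).degree v = 2)
    ⟨v₀, Finset.mem_filter.2 ⟨hv₀, hdeg⟩⟩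
  obtain ⟨hvS, hv2⟩ := Finset.mem_filter.1 hv
  obtain ⟨a, b, hab, hw⟩ := degree_eq_two_iff.1 hv2
  have ha := (hw a).2 (.inl rfl)
  have hb := (hw b).2 (.inr rfl)
  have ha' := hS v hvS a (hM.adj_iff.1 ha)
  have hb' := hS v hvS b (hM.adj_iff.1 hb)
  exact hab (h a (Finset.mem_filter.2 ⟨ha'.1, hM.degree_eq_two_of_adj hv2 ha⟩)
    b (Finset.mem_filter.2 ⟨hb'.1, hM.degree_eq_two_of_adj hv2 hb⟩) ha'.2 hb'.2)

lemma adj_unique_of_mem_matchingsIn {S : Finset V} (hM : M ∈ matchingsIn G S) {v a b : V}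
    (ha : s(v, a) ∈ M) (hb : s(v, b) ∈ M) : a = b :=
  Sym2.congr_right.1 ((mem_matchingsIn.1 hM).2.2 _ ha _ hb v (by simp) (by simp))

lemma isSachs_of_mem_matchingsIn {S : Finset V} (hM : M ∈ matchingsIn G S) : IsSachs G M := by
  have hdeg : ∀ v ∈ (fromEdgeSet (M : Set (Sym2 V))).support,
      (fromEdgeSet (M : Set (Sym2 V))).degree v = 1 := by
    rintro v ⟨w, hw⟩
    refine degree_eq_one_of_adj (fun b c hb hc ↦ ?_) hw
    rw [fromEdgeSet_adj, Finset.mem_coe] at hb hc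
    exact adj_unique_of_mem_matchingsIn hM hb.1 hc.1
  exact ⟨fun e he ↦ (mem_matchingsIn.1 hM).1 e he, fun v hv ↦ .inl (hdeg v hv),
    fun v w hvw _ ↦ hdeg w ⟨v, hvw.symm⟩⟩

lemma numCycles_of_mem_matchingsIn {S : Finset V} (hM : M ∈ matchingsIn G S) :
    numCycles M = 0 := by
  rw [numCycles, Nat.card_eq_zero]
  refine .inl ⟨?_⟩
  rintro ⟨K, hK⟩
  induction K using ConnectedComponent.ind with | _ v
  obtain ⟨a, b, hab, h⟩ := degree_eq_two_iff.1 (hK v rfl)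
  have ha := (h a).2 (.inl rfl)
  have hb := (h b).2 (.inr rfl)
  rw [fromEdgeSet_adj, Finset.mem_coe] at ha hb
  exact hab (adj_unique_of_mem_matchingsIn hM ha.1 hb.1)

lemma PS_eq_add_s17 : PS G = matchingCount G Finset.univ +
    ∑ M ∈ Finset.univ.filter (fun M ↦ IsSachs G M ∧ M ∉ matchingsIn G Finset.univ),
      2 ^ numCycles M := by
  rw [PS, ← Finset.sum_filter_add_sum_filter_not _ (fun M ↦ M ∈ matchingsIn G Finset.univ),
    Finset.filter_filter, Finset.filter_filter]
  congr 1
  rw [matchingCount, Finset.card_eq_sum_ones]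
  refine Finset.sum_congr ?_ ?_
  · ext M
    simpa using isSachs_of_mem_matchingsIn
  · intro M hM
    rw [numCycles_of_mem_matchingsIn hM, pow_zero]

section Cycle

variable {r : V} {c : G.Walk r r}

lemma IsSachs.mem_of_mem_edges (hM : IsSachs G M) (hMm : M ∉ matchingsIn G Finset.univ)
    {e : Sym2 V} (hdel : IsOneDegenerate (G.deleteEdges {e})) : e ∈ M := by
  by_contra heM
  refine hMm (hM.mem_matchingsIn (hM.degree_ne_two hdel ?_) subset_rfl (by simp))
  intro v _ w hvw
  refine ⟨Finset.mem_univ _, ?_⟩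
  rw [deleteEdges_adj]
  refine ⟨hM.1 hvw, ?_⟩
  rintro rfl
  exact heM hvw

lemma IsSachs.mem_edges_of_mem_support (hM : IsSachs G M) (hc : c.IsCycle)
    (hcM : ∀ e ∈ c.edges, e ∈ M) {x y : V} (hx : x ∈ c.support) (hxy : s(x, y) ∈ M) :
    s(x, y) ∈ c.edges := by
  have hsub : c.toSubgraph.neighborSet x ⊆ (fromEdgeSet (M : Set (Sym2 V))).neighborSet x := by
    intro w hw
    refine hM.adj_iff.2 (hcM _ ?_)
    rw [← Walk.mem_edges_toSubgraph, Subgraph.mem_edgeSet]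
    exact hw
  have h2 := hc.ncard_neighborSet_toSubgraph_eq_two hx
  have hle : ((fromEdgeSet (M : Set (Sym2 V))).neighborSet x).ncard ≤
      (c.toSubgraph.neighborSet x).ncard := by
    rw [h2, Set.ncard_eq_toFinset_card', ← neighborFinset_def, card_neighborFinset_eq_degree]
    rcases hM.2.1 x ⟨y, hM.adj_iff.2 hxy⟩ with h | h <;> omega
  have heq := Set.eq_of_subset_of_ncard_le hsub hle (Set.toFinite _)
  have hy : y ∈ c.toSubgraph.neighborSet x := heq ▸ hM.adj_iff.2 hxy
  rw [← Walk.mem_edges_toSubgraph, Subgraph.mem_edgeSet]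
  exact hy

lemma IsSachs.degree_ne_two_of_notMem_support (hM : IsSachs G M) (hc : c.IsCycle)
    (hcM : ∀ e ∈ c.edges, e ∈ M) (hdel : ∀ e ∈ c.edges, IsOneDegenerate (G.deleteEdges {e}))
    {x : V} (hx : x ∉ c.support) : (fromEdgeSet (M : Set (Sym2 V))).degree x ≠ 2 := by
  obtain ⟨e, he⟩ : ∃ e, e ∈ c.edges := by
    refine List.exists_mem_of_ne_nil _ fun h ↦ ?_
    have h3 := hc.three_le_length
    rw [← Walk.length_edges, h] at h3
    simp at h3
  refine hM.degree_ne_two (hdel e he) (S := Finset.univ.filter (· ∉ c.support)) ?_ x (by simpa)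
  intro v hv w hvw
  rw [Finset.mem_filter] at hv
  have hne : s(v, w) ∉ c.edges := fun h ↦ hv.2 (c.fst_mem_support_of_mem_edges h)
  refine ⟨?_, ?_⟩
  · rw [Finset.mem_filter]
    refine ⟨Finset.mem_univ _, fun hw ↦ hne ?_⟩
    rw [Sym2.eq_swap] at hvw ⊢
    exact hM.mem_edges_of_mem_support hc hcM hw hvw
  · rw [deleteEdges_adj]
    refine ⟨hM.1 hvw, ?_⟩
    rintro rfl
    exact hne he

lemma IsSachs.numCycles_le_one (hM : IsSachs G M) (hc : c.IsCycle)
    (hcM : ∀ e ∈ c.edges, e ∈ M) (hdel : ∀ e ∈ c.edges, IsOneDegenerate (G.deleteEdges {e})) :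
    numCycles M ≤ 1 := by
  rw [numCycles, Finite.card_le_one_iff_subsingleton]
  have key : ∀ K : (fromEdgeSet (M : Set (Sym2 V))).ConnectedComponent,
      (∀ v, (fromEdgeSet (M : Set (Sym2 V))).connectedComponentMk v = K →
        (fromEdgeSet (M : Set (Sym2 V))).degree v = 2) →
      K = (fromEdgeSet (M : Set (Sym2 V))).connectedComponentMk r := by
    intro K hK
    induction K using ConnectedComponent.ind with | _ v
    have hv : v ∈ c.support := by
      by_contra hv
      exact hM.degree_ne_two_of_notMem_support hc hcM hdel hv (hK v rfl)
    have hT : ∀ e ∈ c.edges, e ∈ (fromEdgeSet (M : Set (Sym2 V))).edgeSet := by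
      intro e he
      induction e with | _ a b
      exact hM.adj_iff.2 (hcM _ he)
    rw [ConnectedComponent.eq]
    exact ((c.transfer _ hT).takeUntil v (by simpa using hv)).reachable.symm
  exact ⟨fun K L ↦ Subtype.ext ((key K.1 K.2).trans (key L.1 L.2).symm)⟩

/-- If deleting any edge of a cycle leaves no cycles, then a Sachs subgraph is either a matching
or consists of the cycle and a matching away from it. -/
lemma PS_le_of_isCycle (hc : c.IsCycle)
    (hdel : ∀ e ∈ c.edges, IsOneDegenerate (G.deleteEdges {e})) :
    PS G ≤ matchingCount G Finset.univ + 2 * matchingCount G c.support.toFinsetᶜ := by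
  rw [PS_eq_add_s17]
  refine Nat.add_le_add_left ?_ _
  have hcM : ∀ M, IsSachs G M ∧ M ∉ matchingsIn G Finset.univ → ∀ e ∈ c.edges, e ∈ M :=
    fun M hM e he ↦ hM.1.mem_of_mem_edges hM.2 (hdel e he)
  refine (Finset.sum_le_card_nsmul _ _ 2 ?_).trans ?_
  · intro M hM
    have hM := (Finset.mem_filter.1 hM).2
    exact (Nat.pow_le_pow_right two_pos (hM.1.numCycles_le_one hc (hcM M hM) hdel)).trans_eq
      (pow_one 2)
  rw [smul_eq_mul, mul_comm]
  refine Nat.mul_le_mul_left _ (Finset.card_le_card_of_injOn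
    (fun M ↦ M.filter (· ∉ c.edges)) ?_ ?_)
  · intro M hM
    have hM := (Finset.mem_filter.1 hM).2
    refine hM.1.mem_matchingsIn ?_ (Finset.filter_subset _ _) ?_
    · intro v hv
      exact hM.1.degree_ne_two_of_notMem_support hc (hcM M hM) hdel (by simpa using hv)
    · rintro e he x ⟨y, rfl⟩
      rw [Finset.mem_filter] at he
      rw [Finset.mem_compl, List.mem_toFinset]
      exact fun hx ↦ he.2 (hM.1.mem_edges_of_mem_support hc (hcM M hM) hx he.1)
  · intro M hM N hN h
    have hM := (Finset.mem_filter.1 hM).2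
    have hN := (Finset.mem_filter.1 hN).2
    ext e
    by_cases he : e ∈ c.edges
    · exact iff_of_true (hcM M hM e he) (hcM N hN e he)
    · have := congrArg (e ∈ ·) h
      simpa [he] using this

end Cycle

section Triangle

variable {a b c : V}

lemma PS_ge_of_triangle (hab : G.Adj a b) (hbc : G.Adj b c) (hac : G.Adj a c) :
    matchingCount G Finset.univ + 2 * matchingCount G ({a, b, c} : Finset V)ᶜ ≤ PS G := by
  rw [PS_eq_add_s17]
  refine Nat.add_le_add_left ?_ _
  let E : Finset (Sym2 V) := {s(a, b), s(b, c), s(a, c)}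
  have hne := hab.ne
  have hne' := hbc.ne
  have hne'' := hac.ne
  have hEmem : ∀ x y, s(x, y) ∈ E ↔
      x ∈ ({a, b, c} : Finset V) ∧ y ∈ ({a, b, c} : Finset V) ∧ x ≠ y := by
    intro x y
    simp only [E, Finset.mem_insert, Finset.mem_singleton, Sym2.eq_iff]
    grind
  have hNE : ∀ N ∈ matchingsIn G ({a, b, c} : Finset V)ᶜ, ∀ x y, s(x, y) ∈ N →
      x ∉ ({a, b, c} : Finset V) := by
    intro N hN x y hxy
    exact Finset.mem_compl.1 ((mem_matchingsIn.1 hN).2.1 _ hxy x (by simp))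
  have hadj : ∀ N ∈ matchingsIn G ({a, b, c} : Finset V)ᶜ, ∀ x y,
      (fromEdgeSet ((N ∪ E : Finset (Sym2 V)) : Set (Sym2 V))).Adj x y ↔
        s(x, y) ∈ N ∨ s(x, y) ∈ E := by
    intro N hN x y
    rw [fromEdgeSet_adj, Finset.mem_coe, Finset.mem_union, and_iff_left_iff_imp]
    rintro (h | h)
    · exact (show G.Adj x y from (mem_matchingsIn.1 hN).1 _ h).ne
    · exact ((hEmem x y).1 h).2.2
  have hdeg2 : ∀ N ∈ matchingsIn G ({a, b, c} : Finset V)ᶜ, ∀ x ∈ ({a, b, c} : Finset V),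
      (fromEdgeSet ((N ∪ E : Finset (Sym2 V)) : Set (Sym2 V))).degree x = 2 := by
    intro N hN x hx
    have h : ∀ y, (fromEdgeSet ((N ∪ E : Finset (Sym2 V)) : Set (Sym2 V))).Adj x y ↔
        y ∈ ({a, b, c} : Finset V) ∧ x ≠ y := by
      intro y
      rw [hadj N hN, hEmem]
      exact ⟨fun h ↦ h.elim (fun h ↦ absurd hx (hNE N hN x y h)) (·.2), fun h ↦ .inr ⟨hx, h⟩⟩
    rw [degree_eq_two_iff]
    simp only [h]
    simp only [Finset.mem_insert, Finset.mem_singleton] at hx ⊢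
    rcases hx with rfl | rfl | rfl
    · exact ⟨b, c, hne', by grind⟩
    · exact ⟨a, c, hne'', by grind⟩
    · exact ⟨a, b, hne, by grind⟩
  have hadj' : ∀ N ∈ matchingsIn G ({a, b, c} : Finset V)ᶜ, ∀ x ∉ ({a, b, c} : Finset V), ∀ y,
      (fromEdgeSet ((N ∪ E : Finset (Sym2 V)) : Set (Sym2 V))).Adj x y ↔ s(x, y) ∈ N := by
    intro N hN x hx y
    rw [hadj N hN, hEmem, or_iff_left]
    exact fun h ↦ hx h.1
  have hdeg1 : ∀ N ∈ matchingsIn G ({a, b, c} : Finset V)ᶜ, ∀ x ∉ ({a, b, c} : Finset V),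
      x ∈ (fromEdgeSet ((N ∪ E : Finset (Sym2 V)) : Set (Sym2 V))).support →
      (fromEdgeSet ((N ∪ E : Finset (Sym2 V)) : Set (Sym2 V))).degree x = 1 := by
    rintro N hN x hx ⟨y, hy⟩
    refine degree_eq_one_of_adj (fun u w hu hw ↦ ?_) hy
    rw [hadj' N hN x hx] at hu hw
    exact adj_unique_of_mem_matchingsIn hN hu hw
  have hSachs : ∀ N ∈ matchingsIn G ({a, b, c} : Finset V)ᶜ, IsSachs G (N ∪ E) := by
    intro N hN
    refine ⟨?_, ?_, ?_⟩
    · intro e he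
      rw [Finset.mem_coe, Finset.mem_union] at he
      rcases he with he | he
      · exact (mem_matchingsIn.1 hN).1 e he
      · simp only [E, Finset.mem_insert, Finset.mem_singleton] at he
        rcases he with rfl | rfl | rfl <;> assumption
    · intro v hv
      by_cases hvT : v ∈ ({a, b, c} : Finset V)
      · exact .inr (hdeg2 N hN v hvT)
      · exact .inl (hdeg1 N hN v hvT hv)
    · intro v w hvw hv
      refine hdeg1 N hN w (fun hw ↦ ?_) ⟨v, hvw.symm⟩
      by_cases hvT : v ∈ ({a, b, c} : Finset V)
      · have := hdeg2 N hN v hvT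
        omega
      · rw [hadj' N hN v hvT, Sym2.eq_swap] at hvw
        exact hNE N hN w v hvw hw
  have hnot : ∀ N ∈ matchingsIn G ({a, b, c} : Finset V)ᶜ,
      N ∪ E ∉ matchingsIn G Finset.univ := by
    intro N _ h
    exact hne' (adj_unique_of_mem_matchingsIn h (v := a)
      (Finset.mem_union_right _ (by simp [E])) (Finset.mem_union_right _ (by simp [E])))
  have hcyc : ∀ N ∈ matchingsIn G ({a, b, c} : Finset V)ᶜ, 1 ≤ numCycles (N ∪ E) := by
    intro N hN
    rw [numCycles, Nat.one_le_iff_ne_zero, Nat.card_ne_zero]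
    refine ⟨⟨⟨connectedComponentMk _ a, fun v hv ↦ hdeg2 N hN v ?_⟩⟩, inferInstance⟩
    obtain ⟨p⟩ := ConnectedComponent.exact hv
    by_contra hvT
    obtain ⟨d, -, h1, h2⟩ := p.exists_boundary_dart {x | x ∉ ({a, b, c} : Finset V)} hvT (by simp)
    have h1 : d.fst ∉ ({a, b, c} : Finset V) := h1
    have h2 : ¬ d.snd ∉ ({a, b, c} : Finset V) := h2
    have := (hadj' N hN _ h1 _).1 d.adj
    rw [Sym2.eq_swap] at this
    exact h2 (hNE N hN _ _ this)
  have himg : ((matchingsIn G ({a, b, c} : Finset V)ᶜ).image (· ∪ E)) ⊆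
      Finset.univ.filter (fun M ↦ IsSachs G M ∧ M ∉ matchingsIn G Finset.univ) := by
    intro M hM
    obtain ⟨N, hN, rfl⟩ := Finset.mem_image.1 hM
    exact Finset.mem_filter.2 ⟨Finset.mem_univ _, hSachs N hN, hnot N hN⟩
  refine le_trans ?_ (Finset.sum_le_sum_of_subset himg)
  rw [Finset.sum_image]
  · rw [matchingCount, mul_comm, ← smul_eq_mul]
    refine Finset.card_nsmul_le_sum _ _ _ fun N hN ↦ ?_
    exact (pow_one 2).symm.trans_le (Nat.pow_le_pow_right two_pos (hcyc N hN))
  · have hdisj : ∀ N ∈ matchingsIn G ({a, b, c} : Finset V)ᶜ, Disjoint N E := by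
      intro N hN
      rw [Finset.disjoint_left]
      intro e he heE
      induction e with | _ x y
      exact hNE N hN x y he ((hEmem x y).1 heE).1
    intro N hN N' hN' h
    have h : (N ∪ E) \ E = (N' ∪ E) \ E := congrArg (· \ E) h
    rwa [Finset.union_sdiff_cancel_right (hdisj N hN),
      Finset.union_sdiff_cancel_right (hdisj N' hN')] at h

end Triangle

end

section

variable [Fintype V] {G : SimpleGraph V} {S T : Finset V}

lemma matchingCount_mono (h : S ⊆ T) : matchingCount G S ≤ matchingCount G T :=
  Finset.card_le_card (matchingsIn_mono h)

lemma PS_ge_of_iso {k : ℕ} (φ : G ≃g (pathGraph k ⊕g cycleGraph 3)) :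
    6 * Nat.fib (k + 1) ≤ PS G := by
  have hadj : ∀ i j : Fin 3, i ≠ j → G.Adj (φ.symm (.inr i)) (φ.symm (.inr j)) := by
    intro i j hij
    rw [φ.symm.map_adj_iff, sum_adj_inr, cycleGraph_three_eq_top]
    exact hij
  obtain ⟨a, ha⟩ : ∃ a, a = φ.symm (.inr 0) := ⟨_, rfl⟩
  obtain ⟨b, hb⟩ : ∃ b, b = φ.symm (.inr 1) := ⟨_, rfl⟩
  obtain ⟨c, hc⟩ : ∃ c, c = φ.symm (.inr 2) := ⟨_, rfl⟩
  have hab : G.Adj a b := by rw [ha, hb]; exact hadj 0 1 (by decide)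
  have hbc : G.Adj b c := by rw [hb, hc]; exact hadj 1 2 (by decide)
  have hac : G.Adj a c := by rw [ha, hc]; exact hadj 0 2 (by decide)
  have hPS := PS_ge_of_triangle hab hbc hac
  obtain ⟨R, hR⟩ : ∃ R, R = ({a, b, c} : Finset V)ᶜ := ⟨_, rfl⟩
  rw [← hR] at hPS
  have haR : a ∉ R := by simp [hR]
  have hbR : b ∉ R := by simp [hR]
  have hcR : c ∉ R := by simp [hR]
  have hpath : Nat.fib (k + 1) ≤ matchingCount G R := by
    have h := fib_length_le_matchingCount (G := G)
      (l := List.ofFn fun i : Fin k ↦ φ.symm (.inl i)) ?_ ?_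
    · rw [List.length_ofFn] at h
      refine h.trans (matchingCount_mono fun x hx ↦ ?_)
      rw [List.mem_toFinset, List.mem_ofFn] at hx
      obtain ⟨i, rfl⟩ := hx
      simp [hR, ha, hb, hc]
    · exact List.nodup_ofFn.2 fun i j hij ↦ by simpa using hij
    · rw [List.isChain_iff_getElem]
      intro i hi
      rw [List.getElem_ofFn, List.getElem_ofFn, φ.symm.map_adj_iff, sum_adj_inl, pathGraph_adj]
      exact .inl rfl
  have huniv : (Finset.univ : Finset V) = insert a (insert b (insert c R)) := by
    ext x
    simp only [hR, Finset.mem_univ, Finset.mem_insert, Finset.mem_compl, Finset.mem_singleton]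
    tauto
  have ha' : a ∉ insert b (insert c R) := by simp [haR, hab.ne, hac.ne]
  have hb' : b ∉ insert c R := by simp [hbR, hbc.ne]
  have h1 : matchingCount G (insert c R) + matchingCount G R ≤
      matchingCount G (insert b (insert c R)) := by
    rw [matchingCount_insert b hb']
    refine Nat.add_le_add_left ?_ _
    have := Finset.single_le_sum (f := fun u ↦ matchingCount G ((insert c R).erase u))
      (fun _ _ ↦ Nat.zero_le _) (show c ∈ (insert c R).filter (G.Adj b) by simp [hbc])
    simpa only [Finset.erase_insert hcR] using this
  have h2 : matchingCount G (insert b (insert c R)) + (matchingCount G R + matchingCount G R) ≤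
      matchingCount G Finset.univ := by
    rw [huniv, matchingCount_insert a ha']
    refine Nat.add_le_add_left ?_ _
    have hsub : ({b, c} : Finset V) ⊆ (insert b (insert c R)).filter (G.Adj a) := by
      intro x hx
      rcases Finset.mem_insert.1 hx with rfl | hx
      · simp [hab]
      · rw [Finset.mem_singleton.1 hx]
        simp [hac]
    refine le_trans ?_ (Finset.sum_le_sum_of_subset hsub)
    rw [Finset.sum_pair hbc.ne]
    refine Nat.add_le_add (matchingCount_mono ?_) (matchingCount_mono ?_)
    · exact fun x hx ↦ Finset.mem_erase.2 ⟨fun h ↦ hbR (h ▸ hx), by simp [hx]⟩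
    · exact fun x hx ↦ Finset.mem_erase.2 ⟨fun h ↦ hcR (h ▸ hx), by simp [hx]⟩
  have h3 := matchingCount_mono (G := G) (Finset.subset_insert c R)
  omega

lemma matchingCount_le_deleteEdges_add (u v : V) :
    matchingCount G Finset.univ ≤ matchingCount (G.deleteEdges {s(u, v)}) Finset.univ +
      matchingCount (G.deleteEdges {s(u, v)}) ({u, v} : Finset V)ᶜ := by
  have hsub : matchingsIn G Finset.univ ⊆ matchingsIn (G.deleteEdges {s(u, v)}) Finset.univ ∪
      (matchingsIn (G.deleteEdges {s(u, v)}) ({u, v} : Finset V)ᶜ).image (insert s(u, v)) := by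
    intro M hM
    rw [mem_matchingsIn] at hM
    obtain ⟨h1, -, h3⟩ := hM
    rw [Finset.mem_union]
    by_cases he : s(u, v) ∈ M
    · refine .inr (Finset.mem_image.2 ⟨M.erase s(u, v), ?_, Finset.insert_erase he⟩)
      rw [mem_matchingsIn]
      refine ⟨fun e h ↦ ?_, fun e h x hx ↦ ?_, fun e he f hf ↦
        h3 e (Finset.mem_of_mem_erase he) f (Finset.mem_of_mem_erase hf)⟩
      · rw [edgeSet_deleteEdges]
        exact ⟨h1 e (Finset.mem_of_mem_erase h), (Finset.mem_erase.1 h).1⟩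
      · rw [Finset.mem_compl, Finset.mem_insert, Finset.mem_singleton, ← Sym2.mem_iff]
        intro hx'
        exact (Finset.mem_erase.1 h).1 (h3 e (Finset.mem_of_mem_erase h) _ he x hx hx')
    · refine .inl (mem_matchingsIn.2 ⟨fun e h ↦ ?_, by simp, h3⟩)
      rw [edgeSet_deleteEdges]
      refine ⟨h1 e h, ?_⟩
      rintro rfl
      exact he h
  exact (Finset.card_le_card hsub).trans ((Finset.card_union_le _ _).trans
    (Nat.add_le_add_left Finset.card_image_le _))

lemma matchingCount_deleteEdges_of_notMem {u v : V} (hu : u ∉ S) :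
    matchingCount G S ≤ matchingCount (G.deleteEdges {s(u, v)}) S := by
  refine Finset.card_le_card fun M hM ↦ ?_
  rw [mem_matchingsIn] at hM ⊢
  refine ⟨fun e he ↦ ?_, hM.2⟩
  rw [edgeSet_deleteEdges]
  refine ⟨hM.1 e he, ?_⟩
  rintro rfl
  exact hu (hM.2.1 _ he u (by simp))

end

lemma IsOneDegenerate.eq_add_one_of_adj {G : SimpleGraph V} (hG : IsOneDegenerate G)
    {l : List V} (hl : l.Nodup) (hc : l.IsChain G.Adj) {i j : ℕ} (hi : i < l.length)
    (hj : j < l.length) (hadj : G.Adj l[i] l[j]) : i + 1 = j ∨ j + 1 = i := by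
  by_contra! h
  rcases lt_trichotomy i j with hij | rfl | hij
  · exact hG.not_adj_of_isChain hl hc (by omega) hj hadj
  · exact hadj.ne rfl
  · exact hG.not_adj_of_isChain hl hc (by omega) hi hadj.symm

lemma IsOneDegenerate.not_three_adj_of_isChain {G : SimpleGraph V} (hG : IsOneDegenerate G)
    {l : List V} (hl : l.Nodup) (hc : l.IsChain G.Adj) {w x y z : V} (hw : w ∈ l) (hx : x ∈ l)
    (hy : y ∈ l) (hz : z ∈ l) (hxy : x ≠ y) (hxz : x ≠ z) (hyz : y ≠ z) (hwx : G.Adj w x)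
    (hwy : G.Adj w y) (hwz : G.Adj w z) : False := by
  obtain ⟨i, hi, rfl⟩ := List.mem_iff_getElem.1 hw
  obtain ⟨j, hj, rfl⟩ := List.mem_iff_getElem.1 hx
  obtain ⟨k, hk, rfl⟩ := List.mem_iff_getElem.1 hy
  obtain ⟨n, hn, rfl⟩ := List.mem_iff_getElem.1 hz
  have h1 := hG.eq_add_one_of_adj hl hc hi hj hwx
  have h2 := hG.eq_add_one_of_adj hl hc hi hk hwy
  have h3 := hG.eq_add_one_of_adj hl hc hi hn hwz
  have h4 : j ≠ k := by rintro rfl; exact hxy rfl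
  have h5 : j ≠ n := by rintro rfl; exact hxz rfl
  have h6 : k ≠ n := by rintro rfl; exact hyz rfl
  omega

lemma IsOneDegenerate.nonempty_iso_pathGraph {G : SimpleGraph V} (hG : IsOneDegenerate G)
    {l : List V} (hl : l.Nodup) (hc : l.IsChain G.Adj) (hmem : ∀ v, v ∈ l) :
    Nonempty (G ≃g pathGraph l.length) := by
  refine ⟨Iso.symm ⟨hl.getEquivOfForallMemList l hmem, ?_⟩⟩
  intro i j
  rw [pathGraph_adj]
  refine ⟨fun h ↦ hG.eq_add_one_of_adj hl hc i.2 j.2 h, ?_⟩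
  rw [List.isChain_iff_getElem] at hc
  obtain ⟨i, hi⟩ := i
  obtain ⟨j, hj⟩ := j
  rintro (rfl | rfl)
  · exact hc i hj
  · exact (hc j hi).symm

lemma IsOneDegenerate.sum_deleteEdges {H : SimpleGraph V} {U : SimpleGraph W} {e : Sym2 W}
    (hH : IsOneDegenerate H) (hU : IsOneDegenerate (U.deleteEdges {e})) :
    IsOneDegenerate ((H ⊕g U).deleteEdges {e.map Sum.inr}) := by
  refine (hH.sum hU).anti ?_
  rintro (a | a) (b | b) h
  all_goals simp only [deleteEdges_adj] at h
  · simpa using h.1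
  · simp at h
  · simp at h
  · rw [sum_adj_inr] at h ⊢
    rw [deleteEdges_adj]
    refine ⟨h.1, ?_⟩
    rintro rfl
    exact h.2 (by simp)

section Unicyclic

local instance decidableEqSum : DecidableEq (V ⊕ W) := Classical.decEq _

variable [Fintype V] [Fintype W] {H : SimpleGraph V} {U : SimpleGraph W}

lemma matchingCount_sum_le {G : SimpleGraph (V ⊕ W)} (hG : IsOneDegenerate G)
    (hle : G ≤ H ⊕g U) (T : Finset W) :
    matchingCount G (Finset.univ.map .inl ∪ T.map .inr) ≤
      Nat.fib (Fintype.card V + 1) * matchingCount G (T.map .inr) := by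
  have := matchingCount_union_le (S := Finset.univ.map .inl) (R := T.map .inr) hG ?_ ?_
  · simpa using this
  · rw [Finset.disjoint_left]
    simp
  · intro a ha b hb hab
    have := hle hab
    obtain ⟨x, -, rfl⟩ := Finset.mem_map.1 ha
    obtain ⟨y, -, rfl⟩ := Finset.mem_map.1 hb
    simp at this

lemma matchingCount_sum_le_fib {G : SimpleGraph (V ⊕ W)} (hG : IsOneDegenerate G)
    (hle : G ≤ H ⊕g U) (T : Finset W) :
    matchingCount G (Finset.univ.map .inl ∪ T.map .inr) ≤
      Nat.fib (Fintype.card V + 1) * Nat.fib (#T + 1) := by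
  refine (matchingCount_sum_le hG hle T).trans (Nat.mul_le_mul_left _ ?_)
  simpa using matchingCount_le (S := T.map .inr) hG

lemma compl_map_inr (T : Finset W) :
    (T.map .inr : Finset (V ⊕ W))ᶜ = Finset.univ.map .inl ∪ Tᶜ.map .inr := by
  ext (x | x) <;> simp

lemma exists_isCycle_of_card_edgeFinset (hUc : U.Connected)
    (hUe : #U.edgeFinset = Fintype.card W) :
    ∃ (r : W) (c : U.Walk r r), c.IsCycle ∧
      ∀ e ∈ c.edges, IsOneDegenerate (U.deleteEdges {e}) := by
  have hnot : ¬ U.IsAcyclic := fun h ↦ by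
    have := (IsTree.mk hUc h).card_edgeFinset
    omega
  rw [IsAcyclic] at hnot
  push Not at hnot
  obtain ⟨r, c, hc⟩ := hnot
  refine ⟨r, c, hc, fun e he ↦ .of_isAcyclic ?_⟩
  have hbr : ¬ U.IsBridge e := fun h ↦ h.notMem_edges_of_isCycle hc he
  have heU := c.edges_subset_edgeSet he
  induction e with | _ x y
  have hcon := hUc.connected_delete_edge_of_not_isBridge hbr
  refine IsTree.isAcyclic (isTree_iff_connected_and_card.2 ⟨hcon, ?_⟩)
  rw [Nat.card_eq_fintype_card, Nat.card_eq_fintype_card, ← edgeFinset_card]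
  have : (U.deleteEdges {s(x, y)}).edgeFinset = U.edgeFinset.erase s(x, y) := by
    ext f
    simp [and_comm]
  rw [this, ← hUe]
  exact Finset.card_erase_add_one (by simpa using heU)

/-- A cycle missing some vertex of a connected graph has an edge avoiding a vertex of the cycle
with a neighbour off the cycle. -/
lemma exists_edge_and_branch_vertex {r : W} {c : U.Walk r r} (hc : c.IsCycle) :
    ∃ u v, s(u, v) ∈ c.edges ∧ (U.Connected → c.support.toFinset ≠ Finset.univ →
      ∃ w x y z, x ≠ y ∧ x ≠ z ∧ y ≠ z ∧ (U.deleteEdges {s(u, v)}).Adj w x ∧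
        (U.deleteEdges {s(u, v)}).Adj w y ∧ (U.deleteEdges {s(u, v)}).Adj w z) := by
  have hnbr : ∀ x ∈ c.support, ∃ a b, a ≠ b ∧ s(x, a) ∈ c.edges ∧ s(x, b) ∈ c.edges := by
    intro x hx
    obtain ⟨a, b, hab, h⟩ := Set.ncard_eq_two.1 (hc.ncard_neighborSet_toSubgraph_eq_two hx)
    refine ⟨a, b, hab, ?_, ?_⟩ <;>
      · rw [← Walk.mem_edges_toSubgraph, Subgraph.mem_edgeSet, ← Subgraph.mem_neighborSet, h]
        simp
  by_cases hall : U.Connected ∧ c.support.toFinset ≠ Finset.univ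
  · obtain ⟨hUc, hne⟩ := hall
    obtain ⟨q, hq⟩ : ∃ q, q ∉ c.support := by
      by_contra! h
      exact hne (by ext; simp [h])
    obtain ⟨p⟩ := hUc.preconnected r q
    obtain ⟨d, -, hw, hz⟩ := p.exists_boundary_dart {x | x ∈ c.support} c.start_mem_support hq
    have hw : d.fst ∈ c.support := hw
    have hz : d.snd ∉ c.support := hz
    obtain ⟨x, y, hxy, hx, hy⟩ := hnbr _ hw
    obtain ⟨v, hvw, hv⟩ : ∃ v, v ≠ d.fst ∧ s(x, v) ∈ c.edges := by
      obtain ⟨a, b, hab, ha, hb⟩ := hnbr x (c.snd_mem_support_of_mem_edges hx)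
      rcases eq_or_ne a d.fst with rfl | h
      · exact ⟨b, hab.symm, hb⟩
      · exact ⟨a, h, ha⟩
    have hxs := c.snd_mem_support_of_mem_edges hx
    have hys := c.snd_mem_support_of_mem_edges hy
    have hxw : d.fst ≠ x := (show U.Adj d.fst x from c.edges_subset_edgeSet hx).ne
    have hdel : ∀ a, U.Adj d.fst a → (U.deleteEdges {s(x, v)}).Adj d.fst a := by
      intro a ha
      rw [deleteEdges_adj, Set.mem_singleton_iff, Sym2.eq_iff]
      refine ⟨ha, ?_⟩
      rintro (⟨h, -⟩ | ⟨h, -⟩)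
      · exact hxw h
      · exact hvw h.symm
    exact ⟨x, v, hv, fun _ _ ↦ ⟨d.fst, x, y, d.snd, hxy, fun h ↦ hz (h ▸ hxs),
      fun h ↦ hz (h ▸ hys), hdel _ (c.edges_subset_edgeSet hx),
      hdel _ (c.edges_subset_edgeSet hy), hdel _ d.adj⟩⟩
  · obtain ⟨a, -, -, ha, -⟩ := hnbr r c.start_mem_support
    exact ⟨r, a, ha, fun h1 h2 ↦ absurd ⟨h1, h2⟩ hall⟩

/-- The permanental sum of a forest together with a connected unicyclic graph, bounded through
the matchings of the forest obtained by deleting one edge of the cycle. -/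
lemma exists_PS_sum_le (hH : IsOneDegenerate H) (hUc : U.Connected)
    (hUe : #U.edgeFinset = Fintype.card W) :
    ∃ (G : SimpleGraph (V ⊕ W)) (C T : Finset W), IsOneDegenerate G ∧ G ≤ H ⊕g U ∧
      #T + 2 = Fintype.card W ∧ 3 ≤ #C ∧
      PS (H ⊕g U) ≤ matchingCount G (Finset.univ.map .inl ∪ Finset.univ.map .inr) +
        matchingCount G (Finset.univ.map .inl ∪ T.map .inr) +
        2 * matchingCount G (Finset.univ.map .inl ∪ Cᶜ.map .inr) ∧
      (C ≠ Finset.univ → matchingCount G (Finset.univ.map .inl ∪ Finset.univ.map .inr) <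
        Nat.fib (Fintype.card V + 1) * Nat.fib (Fintype.card W + 1)) := by
  obtain ⟨r, c, hc, hdel⟩ := exists_isCycle_of_card_edgeFinset hUc hUe
  obtain ⟨u, v, huv, hbranch⟩ := exists_edge_and_branch_vertex hc
  have hne : u ≠ v := (show U.Adj u v from c.edges_subset_edgeSet huv).ne
  have hGd := hH.sum_deleteEdges (hdel _ huv)
  rw [Sym2.map_mk] at hGd
  refine ⟨(H ⊕g U).deleteEdges {s(Sum.inr u, Sum.inr v)}, c.support.toFinset, {u, v}ᶜ, hGd,
    deleteEdges_le _, ?_, ?_, ?_, ?_⟩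
  · have h1 := Finset.card_add_card_compl ({u, v} : Finset W)
    rw [Finset.card_pair hne] at h1
    omega
  · have h3 := hc.three_le_length
    have hnd := hc.support_nodup
    calc 3 ≤ c.support.tail.length := by simpa using h3
      _ = #c.support.tail.toFinset := (List.toFinset_card_of_nodup hnd).symm
      _ ≤ _ := Finset.card_le_card fun x hx ↦ by
        rw [List.mem_toFinset] at hx ⊢
        exact List.mem_of_mem_tail hx
  · have hc' : (c.map (Embedding.sumInr (G := H) (H := U)).toHom).IsCycle :=
      (Walk.isCycle_map_iff_of_injective Sum.inr_injective).2 hc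
    have h1 := PS_le_of_isCycle hc' (fun e he ↦ by
      rw [Walk.edges_map, List.mem_map] at he
      obtain ⟨f, hf, rfl⟩ := he
      exact hH.sum_deleteEdges (hdel f hf))
    have hsupp : (c.map (Embedding.sumInr (G := H) (H := U)).toHom).support.toFinset =
        c.support.toFinset.map .inr := by
      ext x
      simp [Embedding.sumInr]
    rw [hsupp] at h1
    have h2 := matchingCount_le_deleteEdges_add (G := H ⊕g U) (Sum.inr u) (Sum.inr v)
    have h3 := matchingCount_deleteEdges_of_notMem (G := H ⊕g U) (u := Sum.inr u)
      (v := Sum.inr v) (S := (c.support.toFinset.map .inr)ᶜ)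
      (by simpa using c.fst_mem_support_of_mem_edges huv)
    rw [compl_map_inr] at h1 h3
    have hpair : ({Sum.inr u, Sum.inr v} : Finset (V ⊕ W)) =
        ({u, v} : Finset W).map .inr := by simp
    have huniv : (Finset.univ : Finset (V ⊕ W)) =
        Finset.univ.map .inl ∪ Finset.univ.map .inr := by
      ext (x | x) <;> simp
    rw [hpair, compl_map_inr, huniv] at h2
    rw [huniv] at h1
    omega
  · intro hC
    obtain ⟨w, x, y, z, hxy, hxz, hyz, hx, hy, hz⟩ := hbranch hUc hC
    refine (matchingCount_sum_le_fib hGd (deleteEdges_le _) _).lt_of_ne fun heq ↦ ?_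
    have hle := matchingCount_sum_le hGd (deleteEdges_le _) Finset.univ
    have hle' := matchingCount_le (S := Finset.univ.map .inr) hGd
    rw [Finset.card_map] at hle'
    rw [heq] at hle
    have hge := Nat.le_of_mul_le_mul_left hle (Nat.fib_pos.2 (Nat.succ_pos _))
    obtain ⟨l, hnd, hl, hch⟩ := exists_isChain_of_matchingCount_union_eq (R := ∅)
      (S := Finset.univ.map .inr) hGd (Finset.disjoint_empty_right _) (by simp) (by
        rw [Finset.union_empty, matchingCount_empty, mul_one, Finset.card_map]
        exact le_antisymm hle' hge)
    have hmem : ∀ q : W, Sum.inr q ∈ l := by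
      intro q
      rw [← List.mem_toFinset, hl]
      simp
    have hadj : ∀ a b, (U.deleteEdges {s(u, v)}).Adj a b →
        ((H ⊕g U).deleteEdges {s(Sum.inr u, Sum.inr v)}).Adj (.inr a) (.inr b) := by
      intro a b hab
      rw [deleteEdges_adj] at hab ⊢
      refine ⟨by simpa using hab.1, fun h ↦ hab.2 ?_⟩
      simpa using h
    exact hGd.not_three_adj_of_isChain hnd hch (hmem w) (hmem x) (hmem y) (hmem z)
      (by simpa) (by simpa) (by simpa) (hadj _ _ hx) (hadj _ _ hy) (hadj _ _ hz)

lemma nonempty_iso_pathGraph_of_matchingCount_eq {G : SimpleGraph (V ⊕ W)}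
    (hH : IsOneDegenerate H) (hG : IsOneDegenerate G) (hle : G ≤ H ⊕g U)
    (heq : matchingCount G (Finset.univ.map .inl) = Nat.fib (Fintype.card V + 1)) :
    Nonempty (H ≃g pathGraph (Fintype.card V)) := by
  obtain ⟨l, hnd, hl, hch⟩ := exists_isChain_of_matchingCount_union_eq (R := ∅)
    (S := Finset.univ.map .inl) hG (Finset.disjoint_empty_right _) (by simp) (by
      rw [Finset.union_empty, matchingCount_empty, mul_one, Finset.card_map, heq]
      rfl)
  obtain ⟨k, rfl⟩ : l ∈ Set.range (List.map (Sum.inl : V → V ⊕ W)) := by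
    rw [Set.range_list_map]
    intro x hx
    rw [← List.mem_toFinset, hl] at hx
    obtain ⟨y, -, rfl⟩ := Finset.mem_map.1 hx
    exact ⟨y, rfl⟩
  have hnd' : k.Nodup := hnd.of_map _
  have hmem : ∀ v, v ∈ k := by
    intro v
    have : (Sum.inl v : V ⊕ W) ∈ (k.map Sum.inl).toFinset := by rw [hl]; simp
    simpa using this
  have hlen : k.length = Fintype.card V := by
    rw [← List.toFinset_card_of_nodup hnd', ← Finset.card_univ]
    congr 1
    ext v
    simp [hmem]
  rw [List.isChain_map] at hch
  rw [← hlen]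
  exact hH.nonempty_iso_pathGraph hnd'
    (hch.imp fun a b hab ↦ by simpa using hle hab) hmem

lemma eq_top_of_card_edgeFinset (hW : Fintype.card W = 3) (hUe : #U.edgeFinset = 3) :
    U = ⊤ := by
  rw [← edgeFinset_inj]
  refine Finset.eq_of_subset_of_card_le (edgeFinset_mono le_top) ?_
  rw [card_edgeFinset_top_eq_card_choose_two, hW, hUe]
  decide

end Unicyclic

lemma fib_bound_of_le (m s : ℕ) (hm : 1 ≤ m) :
    Nat.fib (m + 1) * Nat.fib (s + 4) + Nat.fib (m + 1) * Nat.fib (s + 2) +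
      2 * (Nat.fib (m + 1) * Nat.fib (s + 1)) ≤ 6 * Nat.fib (m + s + 1) := by
  obtain ⟨m, rfl⟩ := Nat.exists_eq_add_of_le' hm
  have hb : Nat.fib (m + 1 + 1) ≤ 2 * Nat.fib (m + 1) := by
    have := Nat.fib_mono (Nat.le_succ m)
    rw [Nat.fib_add_two]
    simp only [Nat.succ_eq_add_one] at this
    omega
  rw [Nat.fib_add (m + 1) s, show Nat.fib (s + 4) = 3 * Nat.fib (s + 1) + 2 * Nat.fib s by
    simp only [Nat.fib_add_two]; ring, Nat.fib_add_two (n := s)]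
  nlinarith [Nat.mul_le_mul_right (Nat.fib s) hb]

lemma fib_bound_lt_of_full (m s : ℕ) (hm : 1 ≤ m) (hs : 1 ≤ s) (hms : 4 ≤ m + s) :
    Nat.fib (m + 1) * Nat.fib (s + 4) + Nat.fib (m + 1) * Nat.fib (s + 2) +
      2 * Nat.fib (m + 1) < 6 * Nat.fib (m + s + 1) := by
  rcases hs.eq_or_lt with rfl | hs
  · obtain ⟨m, rfl⟩ := Nat.exists_eq_add_of_le' (show 3 ≤ m by omega)
    have h1 := Nat.fib_lt_fib_succ (show 2 ≤ m + 2 by omega)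
    have h2 := Nat.fib_add_two (n := m + 2)
    have h3 := Nat.fib_add_two (n := m + 3)
    simp only [Nat.add_assoc, Nat.reduceAdd] at h1 h2 h3 ⊢
    have h4 : Nat.fib 5 = 5 := rfl
    have h5 : Nat.fib 3 = 2 := rfl
    rw [h4, h5]
    omega
  · have h := fib_bound_of_le m s hm
    have hq : 2 ≤ Nat.fib (s + 1) := Nat.fib_mono (show 3 ≤ s + 1 by omega)
    have hpos : 0 < Nat.fib (m + 1) := Nat.fib_pos.2 (Nat.succ_pos _)
    nlinarith [Nat.mul_le_mul_left (Nat.fib (m + 1)) hq]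

/-- For a forest `H` on `m ≥ 1` vertices and a unicyclic graph `U` on `t ≥ 3` vertices with
`n = m + t ≥ 7`, `PS(H ⊔ U) ≤ 6·F(n-2)`, with equality iff `H ⊔ U ≅ P_{n-3} ⊔ C₃`. -/
theorem PS_forest_unicyclic [Fintype V] [Fintype W] (H : SimpleGraph V) (U : SimpleGraph W)
    (m t n : ℕ) (hm : Fintype.card V = m) (ht : Fintype.card W = t)
    (hm1 : 1 ≤ m) (ht3 : 3 ≤ t) (hn : n = m + t) (hn7 : 7 ≤ n)
    (hHforest : H.IsAcyclic) (hUc : U.Connected) (hUe : U.edgeFinset.card = t) :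
    PS (H ⊕g U) ≤ 6 * Nat.fib (n - 2) ∧
    (PS (H ⊕g U) = 6 * Nat.fib (n - 2) ↔
      Nonempty ((H ⊕g U) ≃g (pathGraph (n - 3) ⊕g cycleGraph 3))) := by
  have hH := IsOneDegenerate.of_isAcyclic hHforest
  obtain ⟨s, rfl⟩ := Nat.exists_eq_add_of_le' ht3
  subst hm
  obtain ⟨G, C, T, hG, hle, hT, hC, hPS, hlt⟩ := exists_PS_sum_le hH hUc (hUe.trans ht.symm)
  have hA := matchingCount_sum_le_fib hG hle Finset.univ
  have hB := matchingCount_sum_le_fib hG hle T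
  have hD := matchingCount_sum_le_fib hG hle Cᶜ
  have hcard := Finset.card_add_card_compl C
  rw [Finset.card_univ] at hA
  rw [ht] at hA hT hcard hlt
  rw [show #T = s + 1 by omega] at hB
  have hD' := hD.trans (Nat.mul_le_mul_left (Nat.fib (Fintype.card V + 1))
    (Nat.fib_mono (show #Cᶜ + 1 ≤ s + 1 by omega)))
  simp only [Nat.add_assoc, Nat.reduceAdd] at hA hB hlt
  have hbound := fib_bound_of_le (Fintype.card V) s hm1
  have hn2 : n - 2 = Fintype.card V + s + 1 := by omega
  rw [hn2]
  have hupper : PS (H ⊕g U) ≤ 6 * Nat.fib (Fintype.card V + s + 1) := by omega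
  refine ⟨hupper, fun heq ↦ ?_, ?_⟩
  · have hCu : C = Finset.univ := by
      by_contra h
      have := hlt h
      omega
    have hs : s = 0 := by
      by_contra hs
      have hfull := fib_bound_lt_of_full (Fintype.card V) s hm1 (by omega) (by omega)
      rw [hCu, Finset.compl_univ, Finset.card_empty, zero_add, Nat.fib_one, mul_one] at hD
      rw [hCu, Finset.compl_univ] at hPS
      omega
    subst hs
    rw [hCu, Finset.compl_univ, Finset.map_empty, @Finset.union_empty _ decidableEqSum] at hD' hPS
    norm_num [Nat.fib_add_two] at hA hB hD' hPS heq
    obtain ⟨φ⟩ := nonempty_iso_pathGraph_of_matchingCount_eq hH hG hle (by omega)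
    have hU := eq_top_of_card_edgeFinset ht hUe
    subst hU
    rw [cycleGraph_three_eq_top, show n - 3 = Fintype.card V by omega]
    exact ⟨φ.sumCongr (Iso.completeGraph (Fintype.equivFinOfCardEq ht))⟩
  · rintro ⟨φ⟩
    have := PS_ge_of_iso φ
    rw [show n - 3 + 1 = Fintype.card V + s + 1 by omega] at this
    exact le_antisymm hupper this

end PermSum
end
end
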